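/- arXiv:math/0506303 — 4 statements merged into one kernel-verified Lean document; each statement's English description precedes it below -/
import Mathlib

section
/- Let γ be the growth function of the Mealy automaton A₁. Then γ(1) = 3, γ(2) = 8, γ(3) = 14, and for every integer n ≥ 2, γ(2n) = 23·2^(n−2) − 1 and γ(2n+1) = 32·2^(n−2) − 1. In particular γ is a composite function: for even arguments ≥ 4 it is given by one exponential expression and for odd arguments ≥ 5 by a different one. -/
/-- The sequence of states visited by a Mealy automaton with transition function `tr`,
started at state `q`, while reading the infinite word `u`. -/
def stateSeq {X Q : Type*} (tr : X → Q → Q) (q : Q) (u : ℕ → X) : ℕ → Q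
  | 0 => q
  | k + 1 => tr (u k) (stateSeq tr q u k)

/-- The automatic transformation of infinite words defined by the Mealy automaton with
transition function `tr` and output function `out` at the state `q`. -/
def autTrans {X Q : Type*} (tr : X → Q → Q) (out : X → Q → X) (q : Q) (u : ℕ → X) : ℕ → X :=
  fun n => out (u n) (stateSeq tr q u n)

/-- The transformation given by a word of states: the product (composition, applied from
right to left) of the corresponding automatic transformations. -/
def wordTrans {X Q : Type*} (tr : X → Q → Q) (out : X → Q → X) (w : List Q) :
    (ℕ → X) → (ℕ → X) :=
  (w.map (autTrans tr out)).foldr (· ∘ ·) id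

/-- The growth function of a Mealy automaton: `growth tr out n` is the number of distinct
transformations of infinite words obtained as compositions of exactly `n` automatic
transformations of the automaton. -/
noncomputable def growth {X Q : Type*} (tr : X → Q → Q) (out : X → Q → X) (n : ℕ) : ℕ :=
  Set.ncard { g : (ℕ → X) → (ℕ → X) | ∃ w : List Q, w.length = n ∧ wordTrans tr out w = g }

/-- The `i`-th finite difference of a function `γ`. -/
def fdiff (γ : ℕ → ℤ) : ℕ → ℕ → ℤ
  | 0, n => γ n
  | i + 1, n => fdiff γ i n - fdiff γ i (n - 1)

/-- Output function of the automaton `A₁`: states `q0, q1` output `x1` on every letter,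
state `q2` outputs `x0` on every letter. -/
def a1Out : Fin 2 → Fin 3 → Fin 2 := fun _ q => if q = 2 then 0 else 1

/-- Transition function of the automaton `A₁`: `π(x0,q0) = q0`, `π(x1,q0) = q1`,
`π(x0,q1) = q0`, `π(x1,q1) = q2`, `π(x0,q2) = π(x1,q2) = q1`. -/
def a1Tr : Fin 2 → Fin 3 → Fin 3 := fun x q =>
  if q = 2 then 1 else if x = 0 then 0 else if q = 0 then 1 else 2

namespace GA

/-- infinite binary words -/
abbrev Wd := ℕ → Fin 2

/-- the transformation at state `q` -/
def f (q : Fin 3) : Wd → Wd := autTrans a1Tr a1Out q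

/-- states visited -/
abbrev st (q : Fin 3) (u : Wd) (n : ℕ) : Fin 3 := stateSeq a1Tr q u n

lemma f_apply (q : Fin 3) (u : Wd) (n : ℕ) : f q u n = if st q u n = 2 then 0 else 1 := rfl

lemma st_zero (q : Fin 3) (u : Wd) : st q u 0 = q := rfl

lemma st_succ (q : Fin 3) (u : Wd) (n : ℕ) : st q u (n + 1) = a1Tr (u n) (st q u n) := rfl

def Ev (v : Wd) : Prop := ∀ i, v (2 * i) = 1
def Od (v : Wd) : Prop := ∀ i, v (2 * i + 1) = 1

lemma ext2 {u v : Wd} (h0 : u 0 = v 0) (h1 : ∀ i, u (2 * i + 1) = v (2 * i + 1))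
    (h2 : ∀ i, u (2 * i + 2) = v (2 * i + 2)) : u = v := by
  funext n
  rcases Nat.even_or_odd' n with ⟨k, rfl | rfl⟩
  · cases k with
    | zero => exact h0
    | succ k => exact h2 k
  · exact h1 k

def al : Wd := fun n => if n % 2 = 0 then 1 else 0
def be : Wd := fun n => if n % 2 = 0 then 0 else 1
def on : Wd := fun _ => 1
def ka : Wd := fun n => if n = 0 then 1 else if n % 2 = 1 then 1 else 0
def pre (y : Fin 2) (v : Wd) : Wd
  | 0 => 1
  | 1 => y
  | n + 2 => v n

lemma fin2 (x : Fin 2) : x = 0 ∨ x = 1 := by omega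

-- the states on words with 1 at even places
lemma st_ev {q : Fin 3} (hq : q = 0 ∨ q = 2) {v : Wd} (hv : Ev v) (i : ℕ) :
    st q v (2 * i + 1) = 1 ∧ st q v (2 * i + 2) = if v (2 * i + 1) = 1 then 2 else 0 := by
  induction i with
  | zero =>
    have h0 : v 0 = 1 := hv 0
    have h1 : st q v 1 = 1 := by
      rw [st_succ, st_zero, h0]; rcases hq with rfl | rfl <;> rfl
    refine ⟨h1, ?_⟩
    show st q v (1 + 1) = if v 1 = 1 then 2 else 0
    rw [st_succ, h1]
    rcases fin2 (v 1) with h | h <;> rw [h] <;> rfl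
  | succ i ih =>
    have h1 : st q v (2 * (i + 1) + 1) = 1 := by
      rw [st_succ, hv (i + 1), show 2 * (i + 1) = 2 * i + 2 by ring, ih.2]
      split <;> rfl
    refine ⟨h1, ?_⟩
    rw [show 2 * (i + 1) + 2 = (2 * (i + 1) + 1) + 1 by ring, st_succ, h1]
    rcases fin2 (v (2 * (i + 1) + 1)) with h | h <;> rw [h] <;> rfl

lemma st1_ev {v : Wd} (hv : Ev v) (i : ℕ) :
    st 1 v (2 * i) = 1 ∧ st 1 v (2 * i + 1) = 2 := by
  induction i with
  | zero =>
    have h0 : v 0 = 1 := hv 0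
    refine ⟨rfl, ?_⟩
    show st 1 v (0 + 1) = 2
    rw [st_succ, st_zero, h0]; rfl
  | succ i ih =>
    have h1 : st 1 v (2 * (i + 1)) = 1 := by
      rw [show 2 * (i + 1) = (2 * i + 1) + 1 by ring, st_succ, ih.2]; rfl
    refine ⟨h1, ?_⟩
    rw [st_succ, h1, hv (i + 1)]; rfl

-- words with 1 at odd places, started at state 1
lemma st1_od {w : Wd} (hw : Od w) (i : ℕ) :
    st 1 w (2 * i) = 1 ∧ st 1 w (2 * i + 1) = if w (2 * i) = 1 then 2 else 0 := by
  have key : ∀ j, st 1 w j = 1 → st 1 w (j + 1) = if w j = 1 then 2 else 0 := by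
    intro j hj
    rw [st_succ, hj]
    rcases fin2 (w j) with h | h <;> rw [h] <;> rfl
  induction i with
  | zero => exact ⟨rfl, key 0 rfl⟩
  | succ i ih =>
    have h1 : st 1 w (2 * (i + 1)) = 1 := by
      rw [show 2 * (i + 1) = (2 * i + 1) + 1 by ring, st_succ, ih.2, hw i]; split <;> rfl
    exact ⟨h1, key _ h1⟩

lemma st2_od {w : Wd} (hw : Od w) (i : ℕ) :
    st 2 w (2 * i) = 2 ∧ st 2 w (2 * i + 1) = 1 := by
  have key : ∀ j, st 2 w j = 2 → st 2 w (j + 1) = 1 := by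
    intro j hj
    rw [st_succ, hj]; rfl
  induction i with
  | zero => exact ⟨rfl, key 0 rfl⟩
  | succ i ih =>
    have h1 : st 2 w (2 * (i + 1)) = 2 := by
      rw [show 2 * (i + 1) = (2 * i + 1) + 1 by ring, st_succ, ih.2, hw i]; rfl
    exact ⟨h1, key _ h1⟩

lemma st0_od {w : Wd} (hw : Od w) (h0 : w 0 = 1) (i : ℕ) :
    st 0 w (2 * i + 1) = 1 ∧ st 0 w (2 * i + 2) = 2 := by
  have key : ∀ i, st 0 w (2 * i + 1) = 1 → st 0 w (2 * i + 2) = 2 := by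
    intro i hj
    rw [st_succ, hj, hw i]; rfl
  induction i with
  | zero =>
    have : st 0 w (0 + 1) = 1 := by rw [st_succ, st_zero, h0]; rfl
    exact ⟨this, key 0 this⟩
  | succ i ih =>
    have h1 : st 0 w (2 * (i + 1) + 1) = 1 := by
      rw [st_succ, show 2 * (i + 1) = 2 * i + 2 by ring, ih.2]; rfl
    exact ⟨h1, key _ h1⟩

lemma f1_ev {v : Wd} (hv : Ev v) : f 1 v = al := by
  apply ext2
  · rfl
  · intro i
    rw [f_apply, (st1_ev hv i).2]; simp [al]
  · intro i
    rw [f_apply, show 2 * i + 2 = 2 * (i + 1) by ring, (st1_ev hv _).1]; simp [al]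

lemma f02_odd {q : Fin 3} (hq : q = 0 ∨ q = 2) {v : Wd} (hv : Ev v) : Od (f q v) := by
  intro i
  rw [f_apply, (st_ev hq hv i).1]; rfl

lemma f02_even {q : Fin 3} (hq : q = 0 ∨ q = 2) {v : Wd} (hv : Ev v) (i : ℕ) :
    f q v (2 * i + 2) = if v (2 * i + 1) = 1 then 0 else 1 := by
  rw [f_apply, (st_ev hq hv i).2]; split <;> rfl

lemma f0_zero (u : Wd) : f 0 u 0 = 1 := rfl
lemma f1_zero (u : Wd) : f 1 u 0 = 1 := rfl
lemma f2_zero (u : Wd) : f 2 u 0 = 0 := rfl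

lemma f1_od_even {w : Wd} (hw : Od w) (i : ℕ) : f 1 w (2 * i) = 1 := by
  rw [f_apply, (st1_od hw i).1]; rfl

lemma f1_od_odd {w : Wd} (hw : Od w) (i : ℕ) :
    f 1 w (2 * i + 1) = if w (2 * i) = 1 then 0 else 1 := by
  rw [f_apply, (st1_od hw i).2]; split <;> rfl

lemma f2_od {w : Wd} (hw : Od w) : f 2 w = be := by
  apply ext2
  · rfl
  · intro i
    rw [f_apply, (st2_od hw i).2]; simp [be]
  · intro i
    rw [f_apply, show 2 * i + 2 = 2 * (i + 1) by ring, (st2_od hw _).1]; simp [be]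

lemma f0_od {w : Wd} (hw : Od w) (h0 : w 0 = 1) : f 0 w = ka := by
  apply ext2
  · rfl
  · intro i
    rw [f_apply, (st0_od hw h0 i).1]; simp [ka]
  · intro i
    rw [f_apply, (st0_od hw h0 _).2]; simp [ka]

lemma f0_eq_f1 {w : Wd} (h0 : w 0 = 0) : f 0 w = f 1 w := by
  have key : ∀ n, st 0 w (n + 1) = st 1 w (n + 1) := by
    intro n
    induction n with
    | zero => rw [st_succ, st_succ, st_zero, st_zero, h0]; rfl
    | succ n ih => rw [st_succ, ih, ← st_succ]
  funext n
  cases n with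
  | zero => rfl
  | succ n => rw [f_apply, f_apply, key]

lemma f1f0_ev {v : Wd} (hv : Ev v) : f 1 (f 0 v) = pre 0 v := by
  have ho := f02_odd (q := 0) (Or.inl rfl) hv
  apply ext2
  · rfl
  · intro i
    rw [f1_od_odd ho]
    cases i with
    | zero => rfl
    | succ i =>
      rw [show 2 * (i + 1) = 2 * i + 2 by ring, f02_even (Or.inl rfl) hv]
      show _ = v (2 * i + 1)
      rcases fin2 (v (2 * i + 1)) with h | h <;> rw [h] <;> rfl
  · intro i
    rw [show 2 * i + 2 = 2 * (i + 1) by ring, f1_od_even ho]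
    exact (hv i).symm

lemma f1f2_ev {v : Wd} (hv : Ev v) : f 1 (f 2 v) = pre 1 v := by
  have ho := f02_odd (q := 2) (Or.inr rfl) hv
  apply ext2
  · rfl
  · intro i
    rw [f1_od_odd ho]
    cases i with
    | zero => rfl
    | succ i =>
      rw [show 2 * (i + 1) = 2 * i + 2 by ring, f02_even (Or.inr rfl) hv]
      show _ = v (2 * i + 1)
      rcases fin2 (v (2 * i + 1)) with h | h <;> rw [h] <;> rfl
  · intro i
    rw [show 2 * i + 2 = 2 * (i + 1) by ring, f1_od_even ho]
    exact (hv i).symm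

lemma f0f2_ev {v : Wd} (hv : Ev v) : f 0 (f 2 v) = pre 1 v := by
  rw [f0_eq_f1 (f2_zero v), f1f2_ev hv]

lemma ev_al : Ev al := by intro i; simp [al]
lemma ev_on : Ev on := fun _ => rfl
lemma od_be : Od be := by intro i; simp [be]
lemma od_ka : Od ka := by intro i; simp [ka]
lemma ev_pre {v : Wd} (hv : Ev v) (y : Fin 2) : Ev (pre y v) := by
  intro i
  cases i with
  | zero => rfl
  | succ i => exact hv i

lemma f1_be : f 1 be = on := by
  apply ext2
  · rfl
  · intro i; rw [f1_od_odd od_be]; simp [be, on]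
  · intro i; rw [show 2 * i + 2 = 2 * (i + 1) by ring, f1_od_even od_be]; rfl

lemma f0_be : f 0 be = on := by rw [f0_eq_f1 rfl, f1_be]

lemma f0_al : f 0 al = on := by
  apply ext2
  · rfl
  · intro i; rw [f02_odd (Or.inl rfl) ev_al]; rfl
  · intro i; rw [f02_even (Or.inl rfl) ev_al]; simp [al, on]

lemma f1_ka : f 1 ka = pre 0 on := by
  apply ext2
  · rfl
  · intro i; rw [f1_od_odd od_ka]
    cases i with
    | zero => rfl
    | succ i => simp [ka, on, pre, show 2 * (i + 1) + 1 = (2 * i + 1) + 2 by ring]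
  · intro i; rw [show 2 * i + 2 = 2 * (i + 1) by ring, f1_od_even od_ka]; rfl

lemma pre_al : pre 0 al = al := by
  apply ext2
  · rfl
  · intro i
    cases i with
    | zero => rfl
    | succ i => simp [al, pre, show 2 * (i + 1) + 1 = (2 * i + 1) + 2 by ring]
  · intro i; simp [al, pre]

-- two-letter compositions
def inP (p q : Fin 3) : Bool := p == 1 || (p == 0 && q == 2)

lemma inP_step : ∀ (p q : Fin 3) (x : Fin 2),
    inP (a1Tr (if q = 2 then 0 else 1) p) (a1Tr x q) = !inP p q := by decide

lemma inP_ne : ∀ (p q : Fin 3), inP p q = true → p ≠ 2 := by decide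

lemma inP_seq (p q : Fin 3) (u : Wd) (i : ℕ) :
    inP (st p (f q u) (2 * i)) (st q u (2 * i)) = inP p q ∧
    inP (st p (f q u) (2 * i + 1)) (st q u (2 * i + 1)) = !inP p q := by
  have key : ∀ n, inP (st p (f q u) (n + 1)) (st q u (n + 1))
      = !inP (st p (f q u) n) (st q u n) := by
    intro n
    rw [st_succ, st_succ, f_apply]; exact inP_step _ _ _
  induction i with
  | zero => exact ⟨rfl, key 0⟩
  | succ i ih =>
    have h1 : inP (st p (f q u) (2 * (i + 1))) (st q u (2 * (i + 1))) = inP p q := by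
      rw [show 2 * (i + 1) = (2 * i + 1) + 1 by ring, key, ih.2, Bool.not_not]
    exact ⟨h1, by rw [key, h1]⟩

lemma two_ev (p q : Fin 3) (h : inP p q = true) (u : Wd) : Ev (f p (f q u)) := by
  intro i
  rw [f_apply, if_neg]
  apply inP_ne _ (st q u (2 * i))
  rw [(inP_seq p q u i).1, h]

lemma two_od (p q : Fin 3) (h : inP p q = false) (u : Wd) : Od (f p (f q u)) := by
  intro i
  rw [f_apply, if_neg]
  apply inP_ne _ (st q u (2 * i + 1))
  rw [(inP_seq p q u i).2, h]; rfl

-- sets of transformations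
abbrev Tf := Wd → Wd

def T (n : ℕ) : Set Tf := { g | ∃ w : List (Fin 3), w.length = n ∧ wordTrans a1Tr a1Out w = g }

lemma T_zero : T 0 = {id} := by
  ext g
  constructor
  · rintro ⟨w, hw, rfl⟩
    rw [List.length_eq_zero_iff] at hw
    subst hw; rfl
  · rintro rfl
    exact ⟨[], rfl, rfl⟩

lemma mem_T_succ (n : ℕ) (g : Tf) : g ∈ T (n + 1) ↔ ∃ q, ∃ h ∈ T n, g = f q ∘ h := by
  constructor
  · rintro ⟨w, hw, rfl⟩
    cases w with
    | nil => simp at hw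
    | cons q w => exact ⟨q, _, ⟨w, by simpa using hw, rfl⟩, rfl⟩
  · rintro ⟨q, _, ⟨w, hw, rfl⟩, rfl⟩
    exact ⟨q :: w, by simp [hw], rfl⟩

lemma T_succ (n : ℕ) : T (n + 1) =
    ((f 0 ∘ ·) '' T n ∪ (f 1 ∘ ·) '' T n) ∪ (f 2 ∘ ·) '' T n := by
  ext g
  rw [mem_T_succ]
  constructor
  · rintro ⟨q, h, hh, rfl⟩
    fin_cases q
    · exact Or.inl (Or.inl ⟨h, hh, rfl⟩)
    · exact Or.inl (Or.inr ⟨h, hh, rfl⟩)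
    · exact Or.inr ⟨h, hh, rfl⟩
  · rintro ((⟨h, hh, rfl⟩ | ⟨h, hh, rfl⟩) | ⟨h, hh, rfl⟩)
    · exact ⟨0, h, hh, rfl⟩
    · exact ⟨1, h, hh, rfl⟩
    · exact ⟨2, h, hh, rfl⟩

def L0 : List Tf := [f 0 ∘ f 2, f 1 ∘ f 0, f 1 ∘ f 1]
def L1 : List Tf := [f 0 ∘ f 2 ∘ f 0, f 0 ∘ f 2 ∘ f 1, f 0 ∘ f 2 ∘ f 2,
  f 1 ∘ f 0 ∘ f 0, f 1 ∘ f 0 ∘ f 1, f 1 ∘ f 0 ∘ f 2]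

def E : ℕ → Set Tf
  | 0 => {g | g ∈ L0}
  | 1 => {g | g ∈ L1}
  | n + 2 => ((pre 1 ∘ ·) '' E n ∪ (pre 0 ∘ ·) '' E n) ∪ {fun _ => pre 0 on, fun _ => al}

lemma E_ev (n : ℕ) : ∀ g ∈ E n, ∀ u, Ev (g u) := by
  induction n using Nat.twoStepInduction with
  | zero =>
    intro g hg u
    simp only [E, L0, Set.mem_ofPred_eq, List.mem_cons, List.not_mem_nil, or_false] at hg
    rcases hg with rfl | rfl | rfl <;> exact two_ev _ _ rfl _
  | one =>
    intro g hg u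
    simp only [E, L1, Set.mem_ofPred_eq, List.mem_cons, List.not_mem_nil, or_false] at hg
    rcases hg with rfl | rfl | rfl | rfl | rfl | rfl <;> exact two_ev _ _ rfl _
  | more n ih _ =>
    rintro g ((⟨h, hh, rfl⟩ | ⟨h, hh, rfl⟩) | (rfl | rfl)) u
    · exact ev_pre (ih h hh u) _
    · exact ev_pre (ih h hh u) _
    · exact ev_pre ev_on _
    · exact ev_al

lemma w102 : f 1 ∘ f 0 ∘ f 2 = fun _ => al := by
  funext u; exact f1_ev (two_ev 0 2 rfl u)

lemma al_mem (n : ℕ) : (fun _ => al) ∈ E (n + 1) := by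
  cases n with
  | zero => rw [← w102]; simp [E, L1]
  | succ n => exact Or.inr (Or.inr rfl)

lemma w12 : f 1 ∘ f 2 = f 0 ∘ f 2 := by
  funext u; exact (f0_eq_f1 (f2_zero u)).symm

def L2 : List Tf := [f 0 ∘ f 0, f 0 ∘ f 1, f 0 ∘ f 2, f 1 ∘ f 0, f 1 ∘ f 1,
  f 2 ∘ f 0, f 2 ∘ f 1, f 2 ∘ f 2]

lemma T_one : T 1 = {g | g ∈ [f 0, f 1, f 2]} := by
  ext g
  rw [T_succ, T_zero]
  simp only [Set.image_singleton, Set.mem_union, Set.mem_singleton_iff, Set.mem_ofPred_eq,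
    List.mem_cons, List.not_mem_nil, or_false, Function.comp_id]
  tauto

lemma T_two : T 2 = {g | g ∈ L2} := by
  ext g
  rw [T_succ, T_one]
  simp only [Set.mem_image, Set.mem_union, Set.mem_ofPred_eq, L2,
    List.mem_cons, List.not_mem_nil, or_false, exists_eq_or_imp, exists_eq_left, w12]
  simp only [eq_comm (b := g)]
  tauto

def R (n : ℕ) : Set Tf :=
  E (n + 1) ∪ (((f 0 ∘ ·) '' E n ∪ {fun _ => ka}) ∪ ((f 2 ∘ ·) '' E n ∪ {fun _ => be}))

lemma c_ka {p q : Fin 3} (h : inP p q = false) (hp : p = 0) : f 0 ∘ f p ∘ f q = fun _ => ka := by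
  subst hp
  funext u; exact f0_od (two_od _ _ h u) rfl
lemma c_be {p q : Fin 3} (h : inP p q = false) : f 2 ∘ f p ∘ f q = fun _ => be := by
  funext u; exact f2_od (two_od _ _ h u)
lemma c_al {p q : Fin 3} (h : inP p q = true) : f 1 ∘ f p ∘ f q = fun _ => al := by
  funext u; exact f1_ev (two_ev _ _ h u)

lemma c_12 (q : Fin 3) : f 1 ∘ f 2 ∘ f q = f 0 ∘ f 2 ∘ f q := by
  funext u; exact (f0_eq_f1 (f2_zero _)).symm

lemma T_three : T 3 = R 0 := by
  ext g
  rw [T_succ, T_two]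
  simp only [Set.mem_image, Set.mem_union, Set.mem_ofPred_eq, L2, R, E, L1, L0,
    List.mem_cons, List.not_mem_nil, or_false, exists_eq_or_imp, exists_eq_left,
    Set.mem_singleton_iff, c_12]
  rw [c_ka (p := 0) (q := 0) rfl rfl, c_ka (p := 0) (q := 1) rfl rfl,
    c_be (p := 0) (q := 0) rfl, c_be (p := 0) (q := 1) rfl,
    c_be (p := 2) (q := 0) rfl, c_be (p := 2) (q := 1) rfl, c_be (p := 2) (q := 2) rfl,
    c_al (p := 1) (q := 0) rfl, c_al (p := 1) (q := 1) rfl, c_al (p := 0) (q := 2) rfl]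
  simp only [eq_comm (b := g)]
  tauto

lemma T_eq (n : ℕ) : T (n + 3) = R n := by
  induction n with
  | zero => exact T_three
  | succ n ih =>
    have hE := E_ev n
    have hE1 := E_ev (n + 1)
    rw [T_succ, ih]
    apply Set.Subset.antisymm
    · have on_mem : (fun _ => on) ∈ R (n + 1) :=
        Or.inr (Or.inl (Or.inl ⟨_, al_mem n, by funext u; exact f0_al⟩))
      have ka_mem : (fun _ => ka) ∈ R (n + 1) := Or.inr (Or.inl (Or.inr rfl))
      have be_mem : (fun _ => be) ∈ R (n + 1) := Or.inr (Or.inr (Or.inr rfl))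
      rintro _ ((⟨_, (h | ((⟨h, hh, rfl⟩ | rfl) | (⟨h, hh, rfl⟩ | rfl))), rfl⟩ |
        ⟨_, (h | ((⟨h, hh, rfl⟩ | rfl) | (⟨h, hh, rfl⟩ | rfl))), rfl⟩) |
        ⟨_, (h | ((⟨h, hh, rfl⟩ | rfl) | (⟨h, hh, rfl⟩ | rfl))), rfl⟩)
      · exact Or.inr (Or.inl (Or.inl ⟨_, h, rfl⟩))
      · convert ka_mem using 1
        funext u; exact f0_od (f02_odd (Or.inl rfl) (hE h hh u)) rfl
      · convert ka_mem using 1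
        funext u; exact f0_od od_ka rfl
      · refine Or.inl (Or.inl (Or.inl ⟨h, hh, ?_⟩))
        funext u; exact (f0f2_ev (hE h hh u)).symm
      · convert on_mem using 1
        funext u; exact f0_be
      · refine Or.inl (Or.inr (Or.inr ?_))
        funext u; exact f1_ev (hE1 _ h u)
      · refine Or.inl (Or.inl (Or.inr ⟨h, hh, ?_⟩))
        funext u; exact (f1f0_ev (hE h hh u)).symm
      · refine Or.inl (Or.inr (Or.inl ?_))
        funext u; exact f1_ka
      · refine Or.inl (Or.inl (Or.inl ⟨h, hh, ?_⟩))
        funext u; exact (f1f2_ev (hE h hh u)).symm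
      · convert on_mem using 1
        funext u; exact f1_be
      · exact Or.inr (Or.inr (Or.inl ⟨_, h, rfl⟩))
      · convert be_mem using 1
        funext u; exact f2_od (f02_odd (Or.inl rfl) (hE h hh u))
      · convert be_mem using 1
        funext u; exact f2_od od_ka
      · convert be_mem using 1
        funext u; exact f2_od (f02_odd (Or.inr rfl) (hE h hh u))
      · convert be_mem using 1
        funext u; exact f2_od od_be
    · rintro _ (((⟨h, hh, rfl⟩ | ⟨h, hh, rfl⟩) | (rfl | rfl)) |
        ((⟨h, hh, rfl⟩ | rfl) | (⟨h, hh, rfl⟩ | rfl)))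
      · refine Or.inl (Or.inl ⟨_, Or.inr (Or.inr (Or.inl ⟨h, hh, rfl⟩)), ?_⟩)
        funext u; exact f0f2_ev (hE h hh u)
      · refine Or.inl (Or.inr ⟨_, Or.inr (Or.inl (Or.inl ⟨h, hh, rfl⟩)), ?_⟩)
        funext u; exact f1f0_ev (hE h hh u)
      · refine Or.inl (Or.inr ⟨_, Or.inr (Or.inl (Or.inr rfl)), ?_⟩)
        funext u; exact f1_ka
      · refine Or.inl (Or.inr ⟨_, Or.inl (al_mem n), ?_⟩)
        funext u; exact f1_ev ev_al
      · exact Or.inl (Or.inl ⟨_, Or.inl hh, rfl⟩)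
      · refine Or.inl (Or.inl ⟨_, Or.inr (Or.inl (Or.inr rfl)), ?_⟩)
        funext u; exact f0_od od_ka rfl
      · exact Or.inr ⟨_, Or.inl hh, rfl⟩
      · refine Or.inr ⟨_, Or.inr (Or.inl (Or.inr rfl)), ?_⟩
        funext u; exact f2_od od_ka

-- counting
def tests : List Wd := [fun n => [].getD n 0, fun n => [0, 1, 1].getD n 0,
  fun n => [1, 1].getD n 0, fun n => [0, 0, 1, 1].getD n 0, fun n => [0, 1, 0, 1, 1].getD n 0, fun n => [1, 0, 0, 1, 1].getD n 0]

def ev (g : Tf) : List (List (Fin 2)) := tests.map fun u => (List.range 8).map (g u)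

lemma ncard_list (l : List Tf) (h : (l.map ev).Nodup) : {g | g ∈ l}.ncard = l.length := by
  classical
  have hn : l.Nodup := List.Nodup.of_map _ h
  have : {g | g ∈ l} = ((l.toFinset : Finset Tf) : Set Tf) := by ext; simp
  rw [this, Set.ncard_coe_finset, List.toFinset_card_of_nodup hn]

set_option maxRecDepth 100000 in
lemma card_T_one : (T 1).ncard = 3 := by
  rw [T_one, ncard_list _ (by decide)]; rfl

set_option maxRecDepth 100000 in
lemma card_T_two : (T 2).ncard = 8 := by
  rw [T_two, ncard_list _ (by decide)]; rfl

set_option maxRecDepth 100000 in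
lemma card_E_zero : (E 0).ncard = 3 := by
  rw [E, ncard_list _ (by decide)]; rfl

set_option maxRecDepth 100000 in
lemma card_E_one : (E 1).ncard = 6 := by
  rw [E, ncard_list _ (by decide)]; rfl

lemma E_fin (n : ℕ) : (E n).Finite := by
  induction n using Nat.twoStepInduction with
  | zero => exact List.finite_toSet _
  | one => exact List.finite_toSet _
  | more n ih _ => exact ((ih.image _).union (ih.image _)).union (by simp)

lemma pre_inj {y : Fin 2} {u v : Wd} (h : pre y u = pre y v) : u = v := by
  funext n; exact congrFun h (n + 2)

lemma preC_inj (y : Fin 2) : Function.Injective (fun g : Tf => pre y ∘ g) := by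
  intro g h e
  funext u; exact pre_inj (congrFun e u)

lemma pre_on : on = pre 1 on := by
  funext n
  match n with
  | 0 => rfl
  | 1 => rfl
  | n + 2 => rfl

set_option maxRecDepth 100000 in
lemma on_list : ∀ l ∈ [L0, L1], ev (fun _ => on) ∉ l.map ev := by decide

lemma on_not_mem (n : ℕ) : (fun _ => on) ∉ E n := by
  induction n using Nat.twoStepInduction with
  | zero => intro h; exact on_list L0 (by simp) (List.mem_map_of_mem h)
  | one => intro h; exact on_list L1 (by simp) (List.mem_map_of_mem h)
  | more n ih _ =>
    rintro ((⟨h, hh, e⟩ | ⟨h, hh, e⟩) | (e | e))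
    · apply ih
      convert hh using 1
      funext u
      have := congrFun e u
      rw [pre_on] at this
      exact (pre_inj this).symm
    · exact absurd (show (0 : Fin 2) = 1 from congrFun (congrFun e on) 1) (by decide)
    · exact absurd (show (1 : Fin 2) = 0 from congrFun (congrFun e on) 1) (by decide)
    · exact absurd (show (1 : Fin 2) = 0 from congrFun (congrFun e on) 1) (by decide)

set_option maxRecDepth 100000 in
lemma al_list : ev (fun _ => al) ∉ L0.map ev := by decide

lemma al_not_mem : (fun _ => al) ∉ E 0 := fun h => al_list (List.mem_map_of_mem h)

def U (n : ℕ) : Set Tf := (pre 1 ∘ ·) '' E n ∪ (pre 0 ∘ ·) '' E n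

lemma U_fin (n : ℕ) : (U n).Finite := ((E_fin n).image _).union ((E_fin n).image _)

lemma card_U (n : ℕ) : (U n).ncard = 2 * (E n).ncard := by
  rw [U, Set.ncard_union_eq _ ((E_fin n).image _) ((E_fin n).image _),
    Set.ncard_image_of_injective _ (preC_inj 1), Set.ncard_image_of_injective _ (preC_inj 0)]
  · ring
  · rw [Set.disjoint_left]
    rintro _ ⟨g, _, rfl⟩ ⟨h, _, e⟩
    exact absurd (show (0 : Fin 2) = 1 from congrFun (congrFun e on) 1) (by decide)

lemma mem_U0 (n : ℕ) (v : Wd) : (fun _ => pre 0 v) ∈ U n ↔ (fun _ => v) ∈ E n := by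
  constructor
  · rintro (⟨h, hh, e⟩ | ⟨h, hh, e⟩)
    · exact absurd (show (1 : Fin 2) = 0 from congrFun (congrFun e on) 1) (by decide)
    · convert hh using 1
      funext u
      exact (pre_inj (congrFun e u)).symm
  · intro h
    exact Or.inr ⟨_, h, rfl⟩

lemma E_succ (n : ℕ) : E (n + 2) = insert (fun _ => pre 0 on) (insert (fun _ => al) (U n)) := by
  show U n ∪ {fun _ => pre 0 on, fun _ => al} = _
  ext g
  simp only [Set.mem_union, Set.mem_insert_iff, Set.mem_singleton_iff]
  tauto

lemma card_E_aux (n : ℕ) : (E (n + 2)).ncard = (insert (fun _ => al) (U n)).ncard + 1 := by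
  rw [E_succ, Set.ncard_insert_of_notMem _ ((U_fin n).insert _)]
  rintro (e | h)
  · exact absurd (show (1 : Fin 2) = 0 from congrFun (congrFun e on) 3) (by decide)
  · exact on_not_mem n ((mem_U0 n on).1 h)

lemma card_E_two : (E 2).ncard = 8 := by
  rw [card_E_aux, Set.ncard_insert_of_notMem _ (U_fin 0), card_U, card_E_zero]
  rw [← pre_al, mem_U0]
  exact al_not_mem

lemma card_E_rec (n : ℕ) : (E (n + 3)).ncard = 2 * (E (n + 1)).ncard + 1 := by
  rw [card_E_aux, Set.insert_eq_of_mem, card_U]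
  have := (mem_U0 (n + 1) al).2 (al_mem n)
  rwa [pre_al] at this

lemma card_even (m : ℕ) : (E (2 * m + 2)).ncard + 1 = 9 * 2 ^ m := by
  induction m with
  | zero => rw [card_E_two]; rfl
  | succ m ih =>
    rw [show 2 * (m + 1) + 2 = (2 * m + 1) + 3 by ring, card_E_rec, pow_succ]
    show 2 * (E (2 * m + 2)).ncard + 1 + 1 = _
    omega

lemma card_odd (m : ℕ) : (E (2 * m + 1)).ncard + 1 = 7 * 2 ^ m := by
  induction m with
  | zero => rw [card_E_one]; rfl
  | succ m ih =>
    rw [show 2 * (m + 1) + 1 = (2 * m) + 3 by ring, card_E_rec, pow_succ]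
    omega

lemma f02_inj {q : Fin 3} (hq : q = 0 ∨ q = 2) {u v : Wd} (hu : Ev u) (hv : Ev v)
    (h : f q u = f q v) : u = v := by
  apply ext2
  · rw [show u 0 = 1 from hu 0, show v 0 = 1 from hv 0]
  · intro i
    have := congrFun h (2 * i + 2)
    rw [f02_even hq hu, f02_even hq hv] at this
    rcases fin2 (u (2 * i + 1)) with h1 | h1 <;> rcases fin2 (v (2 * i + 1)) with h2 | h2 <;>
      simp_all
  · intro i
    rw [show 2 * i + 2 = 2 * (i + 1) by ring, hu, hv]

lemma card_f {q : Fin 3} (hq : q = 0 ∨ q = 2) (n : ℕ) :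
    ((f q ∘ ·) '' E n).ncard = (E n).ncard := by
  apply Set.ncard_image_of_injOn
  intro g hg h hh e
  funext u
  exact f02_inj hq (E_ev n g hg u) (E_ev n h hh u) (congrFun e u)

-- if the output has zeros at all positive even places then the word is constant
lemma eq_on_of {q : Fin 3} (hq : q = 0 ∨ q = 2) {u : Wd} (hu : Ev u)
    (h : ∀ i, f q u (2 * i + 2) = 0) : u = on := by
  apply ext2
  · exact hu 0
  · intro i
    have := h i
    rw [f02_even hq hu] at this
    rcases fin2 (u (2 * i + 1)) with h1 | h1
    · rw [h1] at this; exact absurd this (by decide)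
    · exact h1
  · intro i
    exact hu (i + 1)

lemma not_img {q : Fin 3} (hq : q = 0 ∨ q = 2) (n : ℕ) {v : Wd} (hv : ∀ i, v (2 * i + 2) = 0) :
    (fun _ => v) ∉ (f q ∘ ·) '' E n := by
  rintro ⟨g, hg, e⟩
  apply on_not_mem n
  convert hg using 1
  funext u
  refine (eq_on_of hq (E_ev n g hg u) fun i => ?_).symm
  rw [← hv i]
  exact congrFun (congrFun e u) _

lemma card_R (n : ℕ) : (R n).ncard = (E (n + 1)).ncard + 2 * (E n).ncard + 2 := by
  have hf0 := (E_fin n).image (f 0 ∘ ·)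
  have hf2 := (E_fin n).image (f 2 ∘ ·)
  have hs : ∀ v : Wd, ({fun _ => v} : Set Tf).Finite := fun v => Set.finite_singleton _
  have d0 : Disjoint ((f 0 ∘ ·) '' E n) {fun _ => ka} := by
    rw [Set.disjoint_singleton_right]
    exact not_img (Or.inl rfl) n (fun i => by simp [ka])
  have d2 : Disjoint ((f 2 ∘ ·) '' E n) {fun _ => be} := by
    rw [Set.disjoint_singleton_right]
    exact not_img (Or.inr rfl) n (fun i => by simp [be])
  have d02 : Disjoint ((f 0 ∘ ·) '' E n ∪ {fun _ => ka}) ((f 2 ∘ ·) '' E n ∪ {fun _ => be}) := by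
    rw [Set.disjoint_left]
    rintro _ (⟨g, _, rfl⟩ | rfl) (⟨h, _, e⟩ | e)
    · exact absurd (show (0 : Fin 2) = 1 from congrFun (congrFun e on) 0) (by decide)
    · exact absurd (show (1 : Fin 2) = 0 from congrFun (congrFun e on) 0) (by decide)
    · exact absurd (show (0 : Fin 2) = 1 from congrFun (congrFun e on) 0) (by decide)
    · exact absurd (show (1 : Fin 2) = 0 from congrFun (congrFun e on) 0) (by decide)
  have dE : Disjoint (E (n + 1))
      (((f 0 ∘ ·) '' E n ∪ {fun _ => ka}) ∪ ((f 2 ∘ ·) '' E n ∪ {fun _ => be})) := by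
    rw [Set.disjoint_left]
    rintro g hg ((⟨h, hh, rfl⟩ | rfl) | (⟨h, hh, rfl⟩ | rfl))
    · apply on_not_mem (n + 1)
      convert hg using 1
      funext u
      have h1 := E_ev (n + 1) _ hg u
      have h2 := f02_odd (q := 0) (Or.inl rfl) (E_ev n h hh u)
      exact ext2 (h1 0).symm (fun i => (h2 i).symm) (fun i => (h1 (i + 1)).symm)
    · exact absurd (E_ev (n + 1) _ hg on 1) (by decide)
    · exact absurd (show (0 : Fin 2) = 1 from E_ev (n + 1) _ hg on 0) (by decide)
    · exact absurd (E_ev (n + 1) _ hg on 0) (by decide)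
  rw [R, Set.ncard_union_eq dE (E_fin _) ((hf0.union (hs _)).union (hf2.union (hs _))),
    Set.ncard_union_eq d02 (hf0.union (hs _)) (hf2.union (hs _)),
    Set.ncard_union_eq d0 hf0 (hs _), Set.ncard_union_eq d2 hf2 (hs _),
    card_f (Or.inl rfl), card_f (Or.inr rfl), Set.ncard_singleton, Set.ncard_singleton]
  ring

lemma growth_eq (n : ℕ) : growth a1Tr a1Out n = (T n).ncard := rfl

end GA

/-- The growth function `γ` of `A₁` satisfies `γ(1) = 3`, `γ(2) = 8`, `γ(3) = 14`, and for
every `n ≥ 2`, `γ(2n) = 23·2^(n−2) − 1` and `γ(2n+1) = 32·2^(n−2) − 1`; in particular it is a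
composite function, given by different exponential expressions on even and odd arguments. -/
theorem growth_a1 :
    growth a1Tr a1Out 1 = 3 ∧ growth a1Tr a1Out 2 = 8 ∧ growth a1Tr a1Out 3 = 14 ∧
    ∀ n : ℕ, 2 ≤ n →
      growth a1Tr a1Out (2 * n) = 23 * 2 ^ (n - 2) - 1 ∧
      growth a1Tr a1Out (2 * n + 1) = 32 * 2 ^ (n - 2) - 1 := by
  refine ⟨GA.card_T_one, GA.card_T_two, ?_, ?_⟩
  · rw [GA.growth_eq, GA.T_eq 0, GA.card_R, GA.card_E_one, GA.card_E_zero]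
  · intro n hn
    obtain ⟨m, rfl⟩ := Nat.exists_eq_add_of_le hn
    have h1 := GA.card_even m
    have h2 := GA.card_odd m
    have h3 := GA.card_odd (m + 1)
    rw [pow_succ] at h3
    rw [Nat.add_sub_cancel_left]
    constructor
    · rw [GA.growth_eq, show 2 * (2 + m) = (2 * m + 1) + 3 by ring, GA.T_eq, GA.card_R]
      show (GA.E (2 * m + 2)).ncard + _ + 2 = _
      omega
    · rw [GA.growth_eq, show 2 * (2 + m) + 1 = (2 * m + 2) + 3 by ring, GA.T_eq, GA.card_R]
      show (GA.E (2 * (m + 1) + 1)).ncard + _ + 2 = _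
      omega
end

section
/- Let γ be the growth function of the Mealy automaton A₃. Then γ(1) = 2, and for every integer n ≥ 1, γ(2n) = 4n and γ(2n+1) = 5n + 1. In particular γ is a non-monotonic composite function of linear growth (for n ≥ 5, γ(2n−1) = 5n − 4 > 4n = γ(2n)). -/
/-- Output function of the automaton `A₃`: at `q0` the outputs of `(x0,x1,x2,x3)` are
`(x1,x2,x2,x2)`; at `q1` they are `(x3,x0,x2,x2)`. -/
def a3Out : Fin 4 → Fin 2 → Fin 4 := fun x q =>
  if q = 0 then (if x = 0 then 1 else 2)
  else (if x = 0 then 3 else if x = 1 then 0 else 2)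

/-- Transition function of the automaton `A₃`: all transitions from `q0` stay at `q0`;
from `q1` the transition goes to `q0` on reading `x0` and stays at `q1` otherwise. -/
def a3Tr : Fin 4 → Fin 2 → Fin 2 := fun x q =>
  if q = 0 then 0 else (if x = 0 then 0 else 1)

open Classical in
/-- Number of positions `m < n` with `s m`. -/
noncomputable def cntA (s : ℕ → Prop) : ℕ → ℕ
  | 0 => 0
  | n + 1 => cntA s n + if s n then 1 else 0

/-- Letter written on the marked position number `c`. -/
def valA (o : Fin 3) (K c : ℕ) : Fin 4 :=
  if c < K then 2 else if o = 0 then 1 else if o = 1 then 0 else if c = K then 3 else 1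

open Classical in
/-- Word obtained from a set of marked positions. -/
noncomputable def outA (o : Fin 3) (K : ℕ) (s : ℕ → Prop) : ℕ → Fin 4 :=
  fun n => if s n then valA o K (cntA s n) else 2

/-- Positions of ones before the first zero. -/
def selB (u : ℕ → Fin 4) (n : ℕ) : Prop := u n = 1 ∧ ∀ m < n, u m ≠ 0

/-- The three kinds of marked positions. -/
def selA (i : Fin 3) (u : ℕ → Fin 4) (n : ℕ) : Prop :=
  if i = 0 then u n = 0
  else if i = 1 then selB u n
  else u n = 0 ∧ (∃ m < n, u m = 0) ∧ ∀ m, ¬ selB u m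

/-- The transformation `f₀`. -/
def fa : (ℕ → Fin 4) → (ℕ → Fin 4) := autTrans a3Tr a3Out 0
/-- The transformation `f₁`. -/
def fb : (ℕ → Fin 4) → (ℕ → Fin 4) := autTrans a3Tr a3Out 1

lemma fa_apply (u : ℕ → Fin 4) (n : ℕ) : fa u n = if u n = 0 then 1 else 2 := by
  have h : stateSeq a3Tr 0 u n = 0 := by
    induction n with
    | zero => rfl
    | succ k ih => simp [stateSeq, ih, a3Tr]
  simp [fa, autTrans, h, a3Out]

open Classical in
lemma fb_apply (u : ℕ → Fin 4) (n : ℕ) : fb u n =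
    if ∀ m < n, u m ≠ 0 then (if u n = 0 then 3 else if u n = 1 then 0 else 2)
    else if u n = 0 then 1 else 2 := by
  have h : stateSeq a3Tr 1 u n = if ∀ m < n, u m ≠ 0 then 1 else 0 := by
    induction n with
    | zero => simp [stateSeq]
    | succ k ih =>
      rw [stateSeq, ih]
      by_cases h1 : ∀ m < k, u m ≠ 0
      · by_cases h2 : u k = 0
        · have : ¬ ∀ m < k + 1, u m ≠ 0 := fun h => h k (by omega) h2
          rw [if_pos h1, if_neg this]; simp [a3Tr, h2]
        · have : ∀ m < k + 1, u m ≠ 0 := by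
            intro m hm
            rcases Nat.lt_succ_iff_lt_or_eq.mp hm with h | h
            · exact h1 m h
            · rw [h]; exact h2
          rw [if_pos h1, if_pos this]; simp [a3Tr, h2]
      · have : ¬ ∀ m < k + 1, u m ≠ 0 := fun h => h1 fun m hm => h m (by omega)
        rw [if_neg h1, if_neg this]; simp [a3Tr]
  unfold fb autTrans
  rw [h]
  split_ifs <;> simp_all [a3Out]

lemma out_one_zero (K : ℕ) (s : ℕ → Prop) (n : ℕ) :
    outA 1 K s n = 0 ↔ s n ∧ K ≤ cntA s n := by
  unfold outA valA
  by_cases h : s n <;> by_cases h2 : cntA s n < K <;> simp [h, h2] <;> omega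

lemma cnt_le (K : ℕ) (s : ℕ → Prop) (n : ℕ) :
    (∀ m < n, outA 1 K s m ≠ 0) ↔ cntA s n ≤ K := by
  induction n with
  | zero => simp [cntA]
  | succ k ih =>
    rw [Nat.forall_lt_succ_right, ih, cntA, Ne, out_one_zero]
    by_cases h : s k <;> simp [h] <;> omega

lemma cnt_zero (s : ℕ → Prop) (n : ℕ) : cntA s n = 0 ↔ ∀ m < n, ¬ s m := by
  induction n with
  | zero => simp [cntA]
  | succ k ih =>
    rw [Nat.forall_lt_succ_right, ← ih, cntA]
    by_cases h : s k <;> simp [h]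

lemma fa_out0 (K : ℕ) (s : ℕ → Prop) : fa (outA 0 K s) = fun _ => 2 := by
  funext n; rw [fa_apply]; simp only [outA, valA]; split_ifs <;> simp_all
lemma fa_out2 (K : ℕ) (s : ℕ → Prop) : fa (outA 2 K s) = fun _ => 2 := by
  funext n; rw [fa_apply]; simp only [outA, valA]; split_ifs <;> simp_all
lemma fa_out1 (K : ℕ) (s : ℕ → Prop) : fa (outA 1 K s) = outA 0 K s := by
  funext n; rw [fa_apply]; simp only [outA, valA]; split_ifs <;> simp_all
lemma fb_out1 (K : ℕ) (s : ℕ → Prop) : fb (outA 1 K s) = outA 2 K s := by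
  funext n; rw [fb_apply]; simp only [cnt_le, out_one_zero]
  simp only [outA, valA]
  by_cases h1 : s n
  · rcases lt_trichotomy (cntA s n) K with h | h | h
    · simp [h1, h, h.le]
    · simp [h1, h]
    · simp [h1, h.le, h.not_gt, h.not_ge, h.ne']
  · simp [h1]
lemma fb_out0 (K : ℕ) (s : ℕ → Prop) : fb (outA 0 K s) = outA 1 K s := by
  have h : ∀ n, outA 0 K s n ≠ 0 := by
    intro n; simp only [outA, valA]; split_ifs <;> simp_all
  funext n; rw [fb_apply, if_pos (fun m _ => h m), if_neg (h n)]
  simp only [outA, valA]; split_ifs <;> simp_all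
lemma fb_out2 (K : ℕ) (s : ℕ → Prop) : fb (outA 2 K s) = outA 1 (K + 1) s := by
  have h : ∀ n, outA 2 K s n ≠ 0 := by
    intro n; simp only [outA, valA]; split_ifs <;> simp_all
  funext n; rw [fb_apply, if_pos (fun m _ => h m), if_neg (h n)]
  simp only [outA, valA]
  by_cases h1 : s n
  · rcases lt_trichotomy (cntA s n) K with h | h | h
    · simp [h1, h, h.trans (Nat.lt_succ_self K)]
    · simp [h1, h]
    · simp [h1, h.not_gt, h.ne', show ¬ cntA s n < K + 1 by omega]
  · simp [h1]

lemma out_empty (o : Fin 3) (K : ℕ) (s : ℕ → Prop) (h : ∀ n, ¬ s n) :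
    outA o K s = fun _ => 2 := by
  funext n; simp [outA, h]

lemma fa_two : fa (fun _ => 2) = fun _ => 2 := by funext n; simp [fa_apply]
lemma fb_two : fb (fun _ => 2) = fun _ => 2 := by funext n; simp [fb_apply]

lemma fa_eq (u : ℕ → Fin 4) : fa u = outA 0 0 (selA 0 u) := by
  funext n; simp [fa_apply, outA, valA, selA]

lemma fb_zero_iff (u : ℕ → Fin 4) (n : ℕ) : fb u n = 0 ↔ selB u n := by
  rw [fb_apply]; unfold selB
  by_cases h : ∀ m < n, u m ≠ 0
  · rw [if_pos h]; split_ifs <;> simp_all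
  · rw [if_neg h]; split_ifs <;> simp [h]

lemma fab_eq (u : ℕ → Fin 4) : fa (fb u) = outA 0 0 (selA 1 u) := by
  funext n; rw [fa_apply]
  have := fb_zero_iff u n
  by_cases h : selB u n
  · simp [this.2 h, h, outA, valA, selA]
  · have h' : fb u n ≠ 0 := fun e => h (this.1 e)
    simp [h', h, outA, valA, selA]

open Classical in
lemma fbb_eq (u : ℕ → Fin 4) : fb (fb u) =
    if ∃ n, selB u n then outA 2 0 (selA 1 u) else outA 1 0 (selA 2 u) := by
  funext n
  rw [fb_apply]
  have e : (∀ m < n, fb u m ≠ 0) ↔ ∀ m < n, ¬ selB u m := by simp only [Ne, fb_zero_iff]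
  simp only [e, fb_zero_iff]
  by_cases hB : ∃ n, selB u n
  · rw [if_pos hB]
    have hs : selA 1 u = selB u := by funext n; simp [selA]
    rw [hs]
    simp only [outA, valA, cnt_zero]
    by_cases h1 : selB u n
    · simp [h1]
    · simp only [h1, if_false]
      by_cases h2 : ∀ m < n, ¬ selB u m
      · rw [if_pos h2, if_neg]
        intro h3
        rw [fb_apply] at h3
        obtain ⟨k, hk⟩ := hB
        by_cases h4 : ∀ m < n, u m ≠ 0
        · rw [if_pos h4] at h3; split_ifs at h3 <;> simp at h3
        · push Not at h4
          obtain ⟨m, hm, hm0⟩ := h4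
          have : ¬ k < n := fun h => h2 k h hk
          exact hk.2 m (by omega) hm0
      · rw [if_neg h2]
  · rw [if_neg hB]
    push Not at hB
    rw [if_pos (fun m _ => hB m), if_neg (hB n)]
    have e2 : fb u n = 1 ↔ selA 2 u n := by
      simp only [selA]
      rw [fb_apply]
      by_cases h4 : ∀ m < n, u m ≠ 0
      · have h5 : ¬ ∃ m < n, u m = 0 := by push Not; exact h4
        rw [if_pos h4]; simp only [h5]; split_ifs <;> simp_all
      · have h5 : ∃ m < n, u m = 0 := by push Not at h4; exact h4
        rw [if_neg h4]; split_ifs <;> simp_all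
    simp [e2, outA, valA]

open Classical in
lemma pow_even (k : ℕ) (u : ℕ → Fin 4) : fb^[2 * k + 2] u =
    if ∃ n, selB u n then outA 2 k (selA 1 u) else outA 1 k (selA 2 u) := by
  induction k with
  | zero => exact fbb_eq u
  | succ k ih =>
    rw [show 2 * (k + 1) + 2 = (2 * k + 2) + 1 + 1 by ring, Function.iterate_succ_apply',
      Function.iterate_succ_apply', ih]
    split_ifs
    · rw [fb_out2, fb_out1]
    · rw [fb_out1, fb_out2]

open Classical in
lemma pow_odd (k : ℕ) (u : ℕ → Fin 4) : fb^[2 * k + 3] u =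
    if ∃ n, selB u n then outA 1 (k + 1) (selA 1 u) else outA 2 k (selA 2 u) := by
  rw [Function.iterate_succ_apply', pow_even]
  split_ifs
  · rw [fb_out2]
  · rw [fb_out1]

lemma fa_even (k : ℕ) (u : ℕ → Fin 4) : fa (fb^[2 * k + 2] u) = outA 0 k (selA 2 u) := by
  rw [pow_even]
  split_ifs with h
  · rw [fa_out2, out_empty]
    intro n; simp only [selA]; simpa using fun _ _ _ _ => h
  · rw [fa_out1]

lemma fa_odd (k : ℕ) (u : ℕ → Fin 4) : fa (fb^[2 * k + 1] u) = outA 0 k (selA 1 u) := by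
  cases k with
  | zero => exact fab_eq u
  | succ k =>
    rw [show 2 * (k + 1) + 1 = 2 * k + 3 by ring, pow_odd]
    split_ifs with h
    · rw [fa_out1]
    · rw [fa_out2, out_empty]
      intro n; push Not at h; simpa [selA] using h n

/-- Normal forms. -/
inductive NF
  | Z : NF
  | P : NF
  | T : Fin 3 → Fin 3 → ℕ → NF

/-- The transformation of a normal form of length `n`. -/
noncomputable def sem (n : ℕ) : NF → (ℕ → Fin 4) → (ℕ → Fin 4)
  | .Z => fun _ _ => 2
  | .P => fb^[n]
  | .T i o K => fun u => outA o K (selA i u)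

/-- Minimal length. -/
def ml (i o : Fin 3) : ℕ :=
  if i = 0 then (if o = 1 then 2 else 3) else i.val + o.val + 1

/-- Normal forms of length `n`. -/
def inF (n : ℕ) : NF → Prop
  | .Z => True
  | .P => True
  | .T i o K => ∃ j, n = ml i o + 2 * K + 2 * j

/-- The transformations of length `n`. -/
def SS (n : ℕ) : Set ((ℕ → Fin 4) → (ℕ → Fin 4)) :=
  { g | ∃ w : List (Fin 2), w.length = n ∧ wordTrans a3Tr a3Out w = g }

lemma SS_succ (n : ℕ) (g : (ℕ → Fin 4) → (ℕ → Fin 4)) :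
    g ∈ SS (n + 1) ↔ ∃ h ∈ SS n, g = fa ∘ h ∨ g = fb ∘ h := by
  constructor
  · rintro ⟨w, hw, rfl⟩
    cases w with
    | nil => simp at hw
    | cons q w =>
      refine ⟨wordTrans a3Tr a3Out w, ⟨w, by simpa using hw, rfl⟩, ?_⟩
      fin_cases q
      · left; rfl
      · right; rfl
  · rintro ⟨h, ⟨w, hw, rfl⟩, rfl | rfl⟩
    · exact ⟨0 :: w, by simp [hw], rfl⟩
    · exact ⟨1 :: w, by simp [hw], rfl⟩

lemma SS_one (g : (ℕ → Fin 4) → (ℕ → Fin 4)) : g ∈ SS 1 ↔ g = fa ∨ g = fb := by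
  rw [SS_succ]
  constructor
  · rintro ⟨h, ⟨w, hw, rfl⟩, hg⟩
    rw [List.length_eq_zero_iff] at hw
    subst hw
    exact hg
  · intro h
    exact ⟨id, ⟨[], rfl, rfl⟩, h⟩

lemma ml_vals : ml 0 0 = 3 ∧ ml 0 1 = 2 ∧ ml 0 2 = 3 ∧ ml 1 0 = 2 ∧ ml 1 1 = 3 ∧ ml 1 2 = 4 ∧
    ml 2 0 = 3 ∧ ml 2 1 = 4 ∧ ml 2 2 = 5 := by decide

lemma step_aZ (n m : ℕ) : fa ∘ sem n .Z = sem m .Z := by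
  funext u; exact fa_two
lemma step_bZ (n m : ℕ) : fb ∘ sem n .Z = sem m .Z := by
  funext u; exact fb_two
lemma step_bP (n : ℕ) : fb ∘ sem n .P = sem (n + 1) .P := by
  simp only [sem]; rw [Function.iterate_succ']
lemma step_a0 (n m : ℕ) (i : Fin 3) (K : ℕ) : fa ∘ sem n (.T i 0 K) = sem m .Z := by
  funext u; exact fa_out0 K _
lemma step_a1 (n m : ℕ) (i : Fin 3) (K : ℕ) : fa ∘ sem n (.T i 1 K) = sem m (.T i 0 K) := by
  funext u; exact fa_out1 K _
lemma step_a2 (n m : ℕ) (i : Fin 3) (K : ℕ) : fa ∘ sem n (.T i 2 K) = sem m .Z := by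
  funext u; exact fa_out2 K _
lemma step_b0 (n m : ℕ) (i : Fin 3) (K : ℕ) : fb ∘ sem n (.T i 0 K) = sem m (.T i 1 K) := by
  funext u; exact fb_out0 K _
lemma step_b1 (n m : ℕ) (i : Fin 3) (K : ℕ) : fb ∘ sem n (.T i 1 K) = sem m (.T i 2 K) := by
  funext u; exact fb_out1 K _
lemma step_b2 (n m : ℕ) (i : Fin 3) (K : ℕ) :
    fb ∘ sem n (.T i 2 K) = sem m (.T i 1 (K + 1)) := by
  funext u; exact fb_out2 K _
lemma step_aPe (k m : ℕ) : fa ∘ sem (2 * k + 2) .P = sem m (.T 2 0 k) := by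
  funext u; exact fa_even k u
lemma step_aPo (k m : ℕ) : fa ∘ sem (2 * k + 1) .P = sem m (.T 1 0 k) := by
  funext u; exact fa_odd k u

lemma fin3 (i : Fin 3) : i = 0 ∨ i = 1 ∨ i = 2 := by fin_cases i <;> simp

lemma SS_char (n : ℕ) : SS (n + 2) = sem (n + 2) '' {d | inF (n + 2) d} := by
  obtain ⟨m1, m2, m3, m4, m5, m6, m7, m8, m9⟩ := ml_vals
  induction n with
  | zero =>
    have ea : fa = sem 1 (.T 0 0 0) := by funext u; exact fa_eq u
    have eb : fb = sem 1 .P := rfl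
    ext g
    rw [SS_succ]
    simp only [SS_one, exists_eq_or_imp, exists_eq_left]
    have h1 : fa ∘ fa = sem (0 + 2) .Z := by
      funext u
      change fa (fa u) = _
      rw [fa_eq u, fa_out0]; rfl
    have h2 : fb ∘ fa = sem (0 + 2) (.T 0 1 0) := by
      conv_lhs => rw [ea, step_b0 1 (0 + 2)]
    have h3 : fa ∘ fb = sem (0 + 2) (.T 1 0 0) := step_aPo 0 _
    have h4 : fb ∘ fb = sem (0 + 2) .P := step_bP 1
    rw [h1, h2, h3, h4]
    constructor
    · rintro ((rfl | rfl) | (rfl | rfl))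
      · exact ⟨.Z, trivial, rfl⟩
      · exact ⟨.T 0 1 0, ⟨0, by omega⟩, rfl⟩
      · exact ⟨.T 1 0 0, ⟨0, by omega⟩, rfl⟩
      · exact ⟨.P, trivial, rfl⟩
    · rintro ⟨d, hd, rfl⟩
      rcases d with _ | _ | ⟨i, o, K⟩
      · simp
      · simp
      · obtain ⟨j, hj⟩ := hd
        rcases fin3 i with rfl | rfl | rfl <;> rcases fin3 o with rfl | rfl | rfl <;>
          first
          | (exfalso; omega)
          | (obtain rfl : K = 0 := by omega
             simp)
  | succ n ih =>
    ext g
    rw [SS_succ, ih]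
    constructor
    · rintro ⟨_, ⟨d, hd, rfl⟩, hg⟩
      rcases d with _ | _ | ⟨i, o, K⟩
      · rw [step_aZ _ (n + 1 + 2), step_bZ _ (n + 1 + 2), or_self] at hg
        exact ⟨.Z, trivial, hg.symm⟩
      · rcases hg with hg | hg
        · obtain ⟨k, hk | hk⟩ : ∃ k, n + 2 = 2 * k + 2 ∨ n + 2 = 2 * k + 1 :=
            ⟨(n + 1) / 2, by omega⟩
          · rw [hk, step_aPe _ (n + 1 + 2)] at hg
            exact ⟨.T 2 0 k, ⟨0, by omega⟩, hg.symm⟩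
          · rw [hk, step_aPo _ (n + 1 + 2)] at hg
            exact ⟨.T 1 0 k, ⟨0, by omega⟩, hg.symm⟩
        · rw [step_bP] at hg
          exact ⟨.P, trivial, hg.symm⟩
      · obtain ⟨j, hj⟩ := hd
        rcases fin3 o with rfl | rfl | rfl
        · rw [step_a0 _ (n + 1 + 2), step_b0 _ (n + 1 + 2)] at hg
          rcases hg with hg | hg
          · exact ⟨.Z, trivial, hg.symm⟩
          · refine ⟨_, ?_, hg.symm⟩
            rcases fin3 i with rfl | rfl | rfl
            · exact ⟨j + 1, by omega⟩
            · exact ⟨j, by omega⟩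
            · exact ⟨j, by omega⟩
        · rw [step_a1 _ (n + 1 + 2), step_b1 _ (n + 1 + 2)] at hg
          rcases hg with hg | hg
          · refine ⟨_, ?_, hg.symm⟩
            rcases fin3 i with rfl | rfl | rfl
            · exact ⟨j, by omega⟩
            · exact ⟨j + 1, by omega⟩
            · exact ⟨j + 1, by omega⟩
          · refine ⟨_, ?_, hg.symm⟩
            rcases fin3 i with rfl | rfl | rfl <;> exact ⟨j, by omega⟩
        · rw [step_a2 _ (n + 1 + 2), step_b2 _ (n + 1 + 2)] at hg
          rcases hg with hg | hg
          · exact ⟨.Z, trivial, hg.symm⟩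
          · refine ⟨_, ?_, hg.symm⟩
            rcases fin3 i with rfl | rfl | rfl <;> exact ⟨j, by omega⟩
    · rintro ⟨d, hd, rfl⟩
      rcases d with _ | _ | ⟨i, o, K⟩
      · exact ⟨_, ⟨.Z, trivial, rfl⟩, Or.inl (step_aZ _ _).symm⟩
      · exact ⟨_, ⟨.P, trivial, rfl⟩, Or.inr (step_bP _).symm⟩
      · obtain ⟨j, hj⟩ := hd
        rcases fin3 o with rfl | rfl | rfl
        · rcases fin3 i with rfl | rfl | rfl
          · exact ⟨_, ⟨.T 0 1 K, ⟨j, by omega⟩, rfl⟩, Or.inl (step_a1 _ _ _ _).symm⟩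
          · cases j with
            | zero =>
              refine ⟨_, ⟨.P, trivial, rfl⟩, Or.inl ?_⟩
              rw [show n + 2 = 2 * K + 1 by omega]
              exact (step_aPo _ _).symm
            | succ j => exact ⟨_, ⟨.T 1 1 K, ⟨j, by omega⟩, rfl⟩, Or.inl (step_a1 _ _ _ _).symm⟩
          · cases j with
            | zero =>
              refine ⟨_, ⟨.P, trivial, rfl⟩, Or.inl ?_⟩
              rw [show n + 2 = 2 * K + 2 by omega]
              exact (step_aPe _ _).symm
            | succ j => exact ⟨_, ⟨.T 2 1 K, ⟨j, by omega⟩, rfl⟩, Or.inl (step_a1 _ _ _ _).symm⟩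
        · rcases fin3 i with rfl | rfl | rfl
          · cases j with
            | zero =>
              obtain ⟨K, rfl⟩ : ∃ L, K = L + 1 := ⟨K - 1, by omega⟩
              exact ⟨_, ⟨.T 0 2 K, ⟨0, by omega⟩, rfl⟩, Or.inr (step_b2 _ _ _ _).symm⟩
            | succ j => exact ⟨_, ⟨.T 0 0 K, ⟨j, by omega⟩, rfl⟩, Or.inr (step_b0 _ _ _ _).symm⟩
          · exact ⟨_, ⟨.T 1 0 K, ⟨j, by omega⟩, rfl⟩, Or.inr (step_b0 _ _ _ _).symm⟩
          · exact ⟨_, ⟨.T 2 0 K, ⟨j, by omega⟩, rfl⟩, Or.inr (step_b0 _ _ _ _).symm⟩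
        · refine ⟨_, ⟨.T i 1 K, ⟨j, ?_⟩, rfl⟩, Or.inr (step_b1 _ _ _ _).symm⟩
          rcases fin3 i with rfl | rfl | rfl <;> omega

lemma cnt_ge (k n : ℕ) : cntA (fun n => k ≤ n) n = n - k := by
  induction n with
  | zero => simp [cntA]
  | succ m ih => rw [cntA, ih]; split_ifs <;> omega

lemma out_ge (o : Fin 3) (K k : ℕ) (c : ℕ) : outA o K (fun n => k ≤ n) (k + c) = valA o K c := by
  simp [outA, cnt_ge]

lemma val_ne (o : Fin 3) (K : ℕ) : valA o K K ≠ 2 := by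
  rcases fin3 o with rfl | rfl | rfl <;> simp [valA]

lemma out_inj (k : ℕ) (o o' : Fin 3) (K K' : ℕ)
    (h : outA o K (fun n => k ≤ n) = outA o' K' (fun n => k ≤ n)) : o = o' ∧ K = K' := by
  have hv : ∀ c, valA o K c = valA o' K' c := fun c => by
    rw [← out_ge o K k, ← out_ge o' K' k, h]
  have hK : K = K' := by
    rcases lt_trichotomy K K' with h1 | h1 | h1
    · have := hv K
      exact absurd (this.trans (by simp [valA, h1])) (val_ne o K)
    · exact h1
    · have := hv K'
      exact absurd (this.symm.trans (by simp [valA, h1])) (val_ne o' K')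
  refine ⟨?_, hK⟩
  subst hK
  have := hv K
  rcases fin3 o with rfl | rfl | rfl <;> rcases fin3 o' with rfl | rfl | rfl <;>
    simp [valA] at this ⊢

/-- All ones. -/
def u1 : ℕ → Fin 4 := fun _ => 1
/-- All zeros. -/
def u0 : ℕ → Fin 4 := fun _ => 0
/-- A one followed by zeros. -/
def u10 : ℕ → Fin 4 := fun n => if n = 0 then 1 else 0

lemma sB1 (n : ℕ) : selB u1 n := by simp [selB, u1]
lemma sB0 (n : ℕ) : ¬ selB u0 n := by simp [selB, u0]

lemma s01 (n : ℕ) : ¬ selA 0 u1 n := by simp [selA, u1]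
lemma s11 : selA 1 u1 = fun n => 0 ≤ n := by funext n; simp [selA, sB1]
lemma s21 (n : ℕ) : ¬ selA 2 u1 n := by simp [selA, u1]
lemma s00 : selA 0 u0 = fun n => 0 ≤ n := by funext n; simp [selA, u0]
lemma s10 (n : ℕ) : ¬ selA 1 u0 n := by simp [selA, sB0]
lemma s20 : selA 2 u0 = fun n => 1 ≤ n := by
  funext n; simp [selA, sB0]; simp [u0]
  constructor
  · rintro ⟨x, hx⟩; omega
  · intro h; exact ⟨0, by omega⟩
lemma s010 : selA 0 u10 = fun n => 1 ≤ n := by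
  funext n; simp [selA, u10]; omega
lemma s210 (n : ℕ) : ¬ selA 2 u10 n := by
  have : selB u10 0 := by simp [selB, u10]
  simp only [selA]; simpa using fun _ _ _ _ => ⟨0, this⟩

/-- The output is not constant `2`. -/
def nt (v : ℕ → Fin 4) : Prop := ∃ n, v n ≠ 2

lemma nt_out (o : Fin 3) (K k : ℕ) : nt (outA o K (fun n => k ≤ n)) :=
  ⟨k + K, by rw [out_ge]; exact val_ne o K⟩
lemma not_nt (o : Fin 3) (K : ℕ) (s : ℕ → Prop) (h : ∀ n, ¬ s n) : ¬ nt (outA o K s) := by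
  rw [out_empty o K s h]; simp [nt]

lemma ntP (n : ℕ) : nt (sem (n + 2) .P u1) ∧ nt (sem (n + 2) .P u0) := by
  simp only [sem]
  have h1 : ∃ n, selB u1 n := ⟨0, sB1 0⟩
  have h0 : ¬ ∃ n, selB u0 n := fun ⟨n, h⟩ => sB0 n h
  obtain ⟨k, hk | hk⟩ : ∃ k, n + 2 = 2 * k + 2 ∨ n + 2 = 2 * k + 3 := ⟨n / 2, by omega⟩
  · rw [hk, pow_even, pow_even, if_pos h1, if_neg h0, s11, s20]
    exact ⟨nt_out _ _ _, nt_out _ _ _⟩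
  · rw [hk, pow_odd, pow_odd, if_pos h1, if_neg h0, s11, s20]
    exact ⟨nt_out _ _ _, nt_out _ _ _⟩

/-- Signature. -/
def sg (g : (ℕ → Fin 4) → (ℕ → Fin 4)) (a b c : Prop) : Prop :=
  (nt (g u1) ↔ a) ∧ (nt (g u0) ↔ b) ∧ (b ∧ ¬ a → (nt (g u10) ↔ c))

lemma sgZ (n : ℕ) : sg (sem n .Z) False False False := by simp [sg, sem, nt]
lemma sgP (n : ℕ) : sg (sem (n + 2) .P) True True False := by
  simp [sg, ntP]
lemma sgA (n : ℕ) (o : Fin 3) (K : ℕ) : sg (sem n (.T 0 o K)) False True True := by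
  refine ⟨iff_of_false (not_nt _ _ _ s01) id, iff_of_true ?_ trivial,
    fun _ => iff_of_true ?_ trivial⟩ <;> simp only [sem, s00, s010] <;> exact nt_out _ _ _
lemma sgB (n : ℕ) (o : Fin 3) (K : ℕ) : sg (sem n (.T 1 o K)) True False False := by
  refine ⟨iff_of_true ?_ trivial, iff_of_false (not_nt _ _ _ s10) id, fun h => h.1.elim⟩
  simp only [sem, s11]; exact nt_out _ _ _
lemma sgC (n : ℕ) (o : Fin 3) (K : ℕ) : sg (sem n (.T 2 o K)) False True False := by
  refine ⟨iff_of_false (not_nt _ _ _ s21) id, iff_of_true ?_ trivial,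
    fun _ => iff_of_false (not_nt _ _ _ s210) id⟩
  simp only [sem, s20]; exact nt_out _ _ _

lemma sem_inj (n : ℕ) : Function.Injective (sem (n + 2)) := by
  intro d d' h
  have hZ := sgZ (n + 2)
  have hP := sgP n
  rcases d with _ | _ | ⟨i, o, K⟩ <;> rcases d' with _ | _ | ⟨i', o', K'⟩
  · rfl
  · rw [h] at hZ; unfold sg at hZ hP; tauto
  · rw [h] at hZ
    rcases fin3 i' with rfl | rfl | rfl
    · have := sgA (n + 2) o' K'; unfold sg at hZ this; tauto
    · have := sgB (n + 2) o' K'; unfold sg at hZ this; tauto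
    · have := sgC (n + 2) o' K'; unfold sg at hZ this; tauto
  · rw [h] at hP; unfold sg at hZ hP; tauto
  · rfl
  · rw [h] at hP
    rcases fin3 i' with rfl | rfl | rfl
    · have := sgA (n + 2) o' K'; unfold sg at hP this; tauto
    · have := sgB (n + 2) o' K'; unfold sg at hP this; tauto
    · have := sgC (n + 2) o' K'; unfold sg at hP this; tauto
  · rw [← h] at hZ
    rcases fin3 i with rfl | rfl | rfl
    · have := sgA (n + 2) o K; unfold sg at hZ this; tauto
    · have := sgB (n + 2) o K; unfold sg at hZ this; tauto
    · have := sgC (n + 2) o K; unfold sg at hZ this; tauto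
  · rw [← h] at hP
    rcases fin3 i with rfl | rfl | rfl
    · have := sgA (n + 2) o K; unfold sg at hP this; tauto
    · have := sgB (n + 2) o K; unfold sg at hP this; tauto
    · have := sgC (n + 2) o K; unfold sg at hP this; tauto
  · have hA := sgA (n + 2) o K
    have hB := sgB (n + 2) o K
    have hC := sgC (n + 2) o K
    have hA' := sgA (n + 2) o' K'
    have hB' := sgB (n + 2) o' K'
    have hC' := sgC (n + 2) o' K'
    rcases fin3 i with rfl | rfl | rfl <;> rcases fin3 i' with rfl | rfl | rfl
    · have e := congrFun h u0
      simp only [sem, s00] at e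
      obtain ⟨rfl, rfl⟩ := out_inj _ _ _ _ _ e; rfl
    · rw [h] at hA; unfold sg at hA hB'; tauto
    · rw [h] at hA; unfold sg at hA hC'; tauto
    · rw [h] at hB; unfold sg at hB hA'; tauto
    · have e := congrFun h u1
      simp only [sem, s11] at e
      obtain ⟨rfl, rfl⟩ := out_inj _ _ _ _ _ e; rfl
    · rw [h] at hB; unfold sg at hB hC'; tauto
    · rw [h] at hC; unfold sg at hC hA'; tauto
    · rw [h] at hC; unfold sg at hC hB'; tauto
    · have e := congrFun h u0
      simp only [sem, s20] at e
      obtain ⟨rfl, rfl⟩ := out_inj _ _ _ _ _ e; rfl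

/-- Number of admissible `K`. -/
def cF (n : ℕ) (p : Fin 3 × Fin 3) : ℕ :=
  if ml p.1 p.2 ≤ n ∧ (n - ml p.1 p.2) % 2 = 0 then (n - ml p.1 p.2) / 2 + 1 else 0

/-- Encoding of normal forms. -/
def enc : Option (Option ((_ : Fin 3 × Fin 3) × ℕ)) → NF
  | none => .Z
  | some none => .P
  | some (some ⟨p, K⟩) => .T p.1 p.2 K

lemma enc_inj : Function.Injective enc := by
  rintro (_ | _ | ⟨⟨i, o⟩, K⟩) (_ | _ | ⟨⟨i', o'⟩, K'⟩) h <;> simp_all [enc]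

lemma inF_eq (n : ℕ) : {d | inF n d} = enc ''
    ((Finset.insertNone (Finset.insertNone
      (Finset.univ.sigma fun p => Finset.range (cF n p))) : Finset _) : Set _) := by
  have key : ∀ i o K, inF n (.T i o K) ↔ K < cF n (i, o) := by
    intro i o K
    simp only [inF, cF]
    constructor
    · rintro ⟨j, hj⟩
      rw [if_pos (by omega)]; omega
    · intro h
      split_ifs at h with h1
      · exact ⟨(n - ml i o) / 2 - K, by omega⟩
      · omega
  ext d
  constructor
  · intro hd
    rcases d with _ | _ | ⟨i, o, K⟩
    · exact ⟨none, by simp, rfl⟩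
    · exact ⟨some none, by simp, rfl⟩
    · exact ⟨some (some ⟨(i, o), K⟩), by simpa using (key i o K).1 hd, rfl⟩
  · rintro ⟨e, he, rfl⟩
    rcases e with _ | _ | ⟨⟨i, o⟩, K⟩
    · trivial
    · trivial
    · exact (key i o K).2 (by simpa using he)

lemma growth_eq (n : ℕ) : growth a3Tr a3Out (n + 2) = (∑ p, cF (n + 2) p) + 2 := by
  change Set.ncard (SS (n + 2)) = _
  rw [SS_char, Set.ncard_image_of_injective _ (sem_inj n), inF_eq,
    Set.ncard_image_of_injective _ enc_inj, Set.ncard_coe_finset, Finset.card_insertNone,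
    Finset.card_insertNone, Finset.card_sigma]
  simp

lemma growth_even (n : ℕ) : growth a3Tr a3Out (2 * n + 2) = 4 * n + 4 := by
  obtain ⟨m1, m2, m3, m4, m5, m6, m7, m8, m9⟩ := ml_vals
  rw [growth_eq, Fintype.sum_prod_type]
  simp only [Fin.sum_univ_three, cF, m1, m2, m3, m4, m5, m6, m7, m8, m9]
  split_ifs <;> omega

lemma growth_odd (n : ℕ) : growth a3Tr a3Out (2 * n + 3) = 5 * n + 6 := by
  obtain ⟨m1, m2, m3, m4, m5, m6, m7, m8, m9⟩ := ml_vals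
  rw [show 2 * n + 3 = (2 * n + 1) + 2 by ring, growth_eq, Fintype.sum_prod_type]
  simp only [Fin.sum_univ_three, cF, m1, m2, m3, m4, m5, m6, m7, m8, m9]
  split_ifs <;> omega

lemma growth_one : growth a3Tr a3Out 1 = 2 := by
  change Set.ncard (SS 1) = 2
  have : SS 1 = {fa, fb} := by ext g; rw [SS_one]; simp
  rw [this, Set.ncard_pair]
  intro h
  have := congrFun (congrFun h u0) 0
  rw [fa_apply, fb_apply] at this
  simp [u0] at this

/-- The growth function `γ` of `A₃` satisfies `γ(1) = 2` and, for every `n ≥ 1`,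
`γ(2n) = 4n` and `γ(2n+1) = 5n + 1`; in particular `γ` is a non-monotonic composite
function of linear growth (`γ(2n−1) = 5n − 4 > 4n = γ(2n)` for `n ≥ 5`). -/
theorem growth_a3 :
    growth a3Tr a3Out 1 = 2 ∧
    (∀ n : ℕ, 1 ≤ n →
      growth a3Tr a3Out (2 * n) = 4 * n ∧ growth a3Tr a3Out (2 * n + 1) = 5 * n + 1) ∧
    (∀ n : ℕ, 5 ≤ n → growth a3Tr a3Out (2 * n) < growth a3Tr a3Out (2 * n - 1)) := by
  have he : ∀ n : ℕ, 1 ≤ n → growth a3Tr a3Out (2 * n) = 4 * n := by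
    intro n hn
    obtain ⟨m, rfl⟩ : ∃ m, n = m + 1 := ⟨n - 1, by omega⟩
    rw [show 2 * (m + 1) = 2 * m + 2 by ring, growth_even]; ring
  have ho : ∀ n : ℕ, 1 ≤ n → growth a3Tr a3Out (2 * n + 1) = 5 * n + 1 := by
    intro n hn
    obtain ⟨m, rfl⟩ : ∃ m, n = m + 1 := ⟨n - 1, by omega⟩
    rw [show 2 * (m + 1) + 1 = 2 * m + 3 by ring, growth_odd]; ring
  refine ⟨growth_one, fun n hn => ⟨he n hn, ho n hn⟩, fun n hn => ?_⟩
  rw [he n (by omega), show 2 * n - 1 = 2 * (n - 1) + 1 by omega, ho (n - 1) (by omega)]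
  omega
end

section
/- Let γ be the growth function of the Mealy automaton A₄. Then γ(2) = 4; for every integer n ≥ 2, γ(2n) = 4n² − 5n + 6; and for every integer n ≥ 0, γ(2n+1) = (7n² + 3n + 4)/2. In particular γ is a composite non-monotonic function of quadratic growth order. -/
/-- Output function of the automaton `A₄`: at `q0` the outputs of `(x0,x1,x2,x3)` are
`(x0,x0,x1,x1)`; at `q1` they are `(x2,x3,x0,x1)`. -/
def a4Out : Fin 4 → Fin 2 → Fin 4 := fun x q =>
  if q = 0 then (if x = 0 then 0 else if x = 1 then 0 else 1)
  else (if x = 0 then 2 else if x = 1 then 3 else if x = 2 then 0 else 1)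

/-- Transition function of the automaton `A₄`: all transitions from `q0` stay at `q0`;
from `q1` the transition goes to `q0` on reading `x0` and stays at `q1` otherwise. -/
def a4Tr : Fin 4 → Fin 2 → Fin 2 := fun x q =>
  if q = 0 then 0 else (if x = 0 then 0 else 1)

/-- The automatic transformations `f0, f1` of the automaton `A₄` at states `q0, q1`. -/
def a4F (q : Fin 2) : (ℕ → Fin 4) → (ℕ → Fin 4) := autTrans a4Tr a4Out q


set_option linter.unusedSimpArgs false
/-- parameter set of normal forms -/
def InP (n s p k t : ℕ) : Prop :=
  (s = 0 ∧ (
    (t = 2 ∧ p + 2 * k + 2 ≤ n) ∨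
    (k = 0 ∧ t = 0 ∧ p = n) ∨
    (k = 0 ∧ t = 1 ∧ p + 1 = n) ∨
    (1 ≤ k ∧ t = 0 ∧ p + 2 * k ≤ n ∧ p % 2 = n % 2 ∧ (p ≠ 0 ∨ k ≠ 1 ∨ n = 2)) ∨
    (1 ≤ k ∧ t = 1 ∧ p + 2 * k + 1 ≤ n ∧ (p + 1) % 2 = n % 2) ∨
    (1 ≤ k ∧ t = 3 ∧ p + 2 * k + 1 ≤ n ∧ (p + 1) % 2 = n % 2 ∧ (p ≠ 0 ∨ k ≠ 1)))) ∨
  (s = 1 ∧ 2 ≤ p ∧ (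
    (k = 0 ∧ t = 0 ∧ p + 1 = n) ∨
    (p % 2 = 0 ∧ (
      (t = 2 ∧ p + 2 * k + 3 ≤ n) ∨
      (k = 0 ∧ t = 1 ∧ p + 2 = n) ∨
      (1 ≤ k ∧ t = 0 ∧ p + 2 * k + 1 ≤ n ∧ n % 2 = 1) ∨
      (1 ≤ k ∧ t = 1 ∧ p + 2 * k + 2 ≤ n ∧ n % 2 = 0) ∨
      (1 ≤ k ∧ t = 3 ∧ p + 2 * k + 2 ≤ n ∧ n % 2 = 0)))))

instance (n s p k t : ℕ) : Decidable (InP n s p k t) := by unfold InP; infer_instance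

def PF (n : ℕ) : Finset (ℕ × ℕ × ℕ × ℕ) :=
  (Finset.range 2 ×ˢ Finset.range (n + 1) ×ˢ Finset.range (n + 1) ×ˢ Finset.range 4).filter
    (fun x => InP n x.1 x.2.1 x.2.2.1 x.2.2.2)

theorem mem_PF (n : ℕ) (x : ℕ × ℕ × ℕ × ℕ) :
    x ∈ PF n ↔ InP n x.1 x.2.1 x.2.2.1 x.2.2.2 := by
  obtain ⟨s, p, k, t⟩ := x
  simp only [PF, Finset.mem_filter, Finset.mem_product, Finset.mem_range, and_iff_right_iff_imp]
  unfold InP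
  omega

theorem card_PF_two : (PF 2).card = 4 := by decide

def tri (N : ℕ) : Finset (Σ _ : ℕ, ℕ) := (Finset.range N).sigma fun i => Finset.range (i + 1)

theorem two_card_tri (N : ℕ) : 2 * (tri N).card = N * (N + 1) := by
  simp only [tri, Finset.card_sigma, Finset.card_range]
  induction N with
  | zero => simp
  | succ n ih => rw [Finset.sum_range_succ, mul_add, ih]; ring

def sizeE (m c : ℕ) : ℕ :=
  if c = 0 ∨ c = 4 then m else if c = 1 ∨ c = 5 ∨ c = 6 then m - 1
  else if c = 7 ∨ c = 9 ∨ c = 10 then m - 2 else 1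

def mapE (n : ℕ) (x : Σ _ : ℕ, Σ _ : ℕ, ℕ) : ℕ × ℕ × ℕ × ℕ :=
  let i := x.2.1
  let k := x.2.2
  match x.1 with
  | 0 => (0, 2 * (i - k), k, 2)
  | 1 => (0, 2 * (i - k) + 1, k, 2)
  | 2 => (0, n, 0, 0)
  | 3 => (0, n - 1, 0, 1)
  | 4 => if i = 0 then (1, n - 1, 0, 0) else (0, 2 * (i - k), k + 1, 0)
  | 5 => (0, 2 * (i - k) + 1, k + 1, 1)
  | 6 => (0, 2 * (i - k) + 1, k + 1, 3)
  | 7 => (1, 2 * (i - k) + 2, k, 2)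
  | 8 => (1, n - 2, 0, 1)
  | 9 => (1, 2 * (i - k) + 2, k + 1, 1)
  | _ => (1, 2 * (i - k) + 2, k + 1, 3)

def sizeO (m c : ℕ) : ℕ :=
  if c = 2 ∨ c = 3 then 1 else if c = 7 ∨ c = 8 then m - 1 else m

def mapO (n : ℕ) (x : Σ _ : ℕ, Σ _ : ℕ, ℕ) : ℕ × ℕ × ℕ × ℕ :=
  let i := x.2.1
  let k := x.2.2
  match x.1 with
  | 0 => (0, 2 * (i - k), k, 2)
  | 1 => (0, 2 * (i - k) + 1, k, 2)
  | 2 => (0, n, 0, 0)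
  | 3 => (0, n - 1, 0, 1)
  | 4 => (0, 2 * (i - k) + 1, k + 1, 0)
  | 5 => (0, 2 * (i - k), k + 1, 1)
  | 6 => if i = 0 then (1, n - 1, 0, 0) else (0, 2 * (i - k), k + 1, 3)
  | 7 => (1, 2 * (i - k) + 2, k, 2)
  | _ => (1, 2 * (i - k) + 2, k + 1, 0)

theorem mem_idx (C : ℕ) (f : ℕ → ℕ) (c i k : ℕ) :
    (⟨c, i, k⟩ : Σ _ : ℕ, Σ _ : ℕ, ℕ) ∈ (Finset.range C).sigma (fun c => tri (f c)) ↔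
      c < C ∧ i < f c ∧ k ≤ i := by
  simp [tri]

theorem sig_ext {c i k c' i' k' : ℕ} (h1 : c = c') (h2 : i = i') (h3 : k = k') :
    (⟨c, i, k⟩ : Σ _ : ℕ, Σ _ : ℕ, ℕ) = ⟨c', i', k'⟩ := by subst h1 h2 h3; rfl

set_option maxHeartbeats 4000000 in
theorem card_PF_even (m : ℕ) (hm : 2 ≤ m) : (PF (2 * m)).card = 4 * m ^ 2 - 5 * m + 6 := by
  have key : ((Finset.range 11).sigma (fun c => tri (sizeE m c))).card = (PF (2 * m)).card := by
    refine Finset.card_bij (fun x _ => mapE (2 * m) x) ?_ ?_ ?_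
    · rintro ⟨c, i, k⟩ hx
      rw [mem_idx] at hx
      obtain ⟨hc, hi, hk⟩ := hx
      rw [mem_PF]
      interval_cases c <;> simp [sizeE] at hi <;> simp only [mapE] <;> (try split_ifs) <;>
        simp [InP] <;> omega
    · rintro ⟨c, i, k⟩ hx ⟨c', i', k'⟩ hx' h
      rw [mem_idx] at hx hx'
      obtain ⟨hc, hi, hk⟩ := hx
      obtain ⟨hc', hi', hk'⟩ := hx'
      obtain ⟨j, rfl⟩ := Nat.exists_eq_add_of_le hk
      obtain ⟨j', rfl⟩ := Nat.exists_eq_add_of_le hk'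
      clear hk hk'
      interval_cases c <;> interval_cases c' <;>
       simp only [mapE, Nat.add_sub_cancel_left, add_eq_zero] at h <;>
       (try split_ifs at h) <;>
       (try simp only [Prod.mk.injEq, OfNat.ofNat_ne_zero, OfNat.zero_ne_ofNat, zero_ne_one, one_ne_zero,
         false_and, and_false, true_and, and_true, Nat.reduceEqDiff, OfNat.ofNat_ne_one,
         OfNat.one_ne_ofNat] at h) <;>
       simp only [sizeE] at hi hi' <;> norm_num at hi hi' <;>
       (first | (apply sig_ext <;> omega) | (exfalso; omega))
    · rintro ⟨s, p, k, t⟩ hx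
      rw [mem_PF] at hx
      simp only [InP] at hx
      have fin : ∀ c i k', c < 11 → i < sizeE m c → k' ≤ i → mapE (2 * m) ⟨c, i, k'⟩ = (s, p, k, t) →
        ∃ a, ∃ (_ : a ∈ (Finset.range 11).sigma (fun c => tri (sizeE m c))), mapE (2 * m) a = (s, p, k, t) :=
        fun c i k' h1 h2 h3 h4 => ⟨⟨c, i, k'⟩, (mem_idx _ _ _ _ _).2 ⟨h1, h2, h3⟩, h4⟩
      rcases hx with ⟨rfl, ⟨rfl, h⟩ | ⟨rfl, rfl, h⟩ | ⟨rfl, rfl, h⟩ | ⟨h0, rfl, h, h', h''⟩ | ⟨h0, rfl, h, h'⟩ |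
        ⟨h0, rfl, h, h', h''⟩⟩ | ⟨rfl, h1, ⟨rfl, rfl, h⟩ | ⟨h2, ⟨rfl, h⟩ | ⟨rfl, rfl, h⟩ | ⟨h0, rfl, h, h'⟩ |
        ⟨h0, rfl, h, h'⟩ | ⟨h0, rfl, h, h'⟩⟩⟩
      · rcases Nat.mod_two_eq_zero_or_one p with hp | hp
        · exact fin 0 (p / 2 + k) k (by norm_num) (by norm_num [sizeE] <;> omega) (by omega) (by simp only [mapE, Prod.mk.injEq, if_true, true_and, and_true] <;> omega)
        · exact fin 1 (p / 2 + k) k (by norm_num) (by norm_num [sizeE] <;> omega) (by omega) (by simp only [mapE, Prod.mk.injEq, if_true, true_and, and_true] <;> omega)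
      · exact fin 2 0 0 (by norm_num) (by norm_num [sizeE] <;> omega) (by omega) (by simp only [mapE, Prod.mk.injEq, if_true, true_and, and_true] <;> omega)
      · exact fin 3 0 0 (by norm_num) (by norm_num [sizeE] <;> omega) (by omega) (by simp only [mapE, Prod.mk.injEq, if_true, true_and, and_true] <;> omega)
      · apply fin 4 (p / 2 + k - 1) (k - 1)
        · omega
        · simp [sizeE]; omega
        · omega
        · simp only [mapE]; rw [if_neg (by omega)]; simp only [Prod.mk.injEq, true_and, and_true]; omega
      · exact fin 5 (p / 2 + k - 1) (k - 1) (by norm_num) (by norm_num [sizeE] <;> omega) (by omega) (by simp only [mapE, Prod.mk.injEq, if_true, true_and, and_true] <;> omega)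
      · exact fin 6 (p / 2 + k - 1) (k - 1) (by norm_num) (by norm_num [sizeE] <;> omega) (by omega) (by simp only [mapE, Prod.mk.injEq, if_true, true_and, and_true] <;> omega)
      · exact fin 4 0 0 (by norm_num) (by norm_num [sizeE] <;> omega) (by omega) (by simp only [mapE, Prod.mk.injEq, if_true, true_and, and_true] <;> omega)
      · exact fin 7 (p / 2 + k - 1) k (by norm_num) (by norm_num [sizeE] <;> omega) (by omega) (by simp only [mapE, Prod.mk.injEq, if_true, true_and, and_true] <;> omega)
      · exact fin 8 0 0 (by norm_num) (by norm_num [sizeE] <;> omega) (by omega) (by simp only [mapE, Prod.mk.injEq, if_true, true_and, and_true] <;> omega)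
      · omega
      · exact fin 9 (p / 2 + k - 2) (k - 1) (by norm_num) (by norm_num [sizeE] <;> omega) (by omega) (by simp only [mapE, Prod.mk.injEq, if_true, true_and, and_true] <;> omega)
      · exact fin 10 (p / 2 + k - 2) (k - 1) (by norm_num) (by norm_num [sizeE] <;> omega) (by omega) (by simp only [mapE, Prod.mk.injEq, if_true, true_and, and_true] <;> omega)
  rw [← key, Finset.card_sigma]
  have h0 := two_card_tri m
  have h1 := two_card_tri (m - 1)
  have h2 := two_card_tri (m - 2)
  have h3 := two_card_tri 1
  simp only [Finset.sum_range_succ, Finset.sum_range_zero]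
  simp [sizeE]
  obtain ⟨r, rfl⟩ := Nat.exists_eq_add_of_le hm
  have e1 : 2 + r - 1 = r + 1 := by omega
  have e2 : 2 + r - 2 = r := by omega
  rw [e1] at h1 ⊢
  rw [e2] at h2 ⊢
  have : 4 * (2 + r) ^ 2 - 5 * (2 + r) = 4 * r ^ 2 + 11 * r + 6 := by
    apply Nat.sub_eq_of_eq_add; ring
  rw [this]
  nlinarith

set_option maxHeartbeats 4000000 in
theorem card_PF_odd (m : ℕ) : 2 * (PF (2 * m + 1)).card = 7 * m ^ 2 + 3 * m + 4 := by
  have key : ((Finset.range 9).sigma (fun c => tri (sizeO m c))).card = (PF (2 * m + 1)).card := by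
    refine Finset.card_bij (fun x _ => mapO (2 * m + 1) x) ?_ ?_ ?_
    · rintro ⟨c, i, k⟩ hx
      rw [mem_idx] at hx
      obtain ⟨hc, hi, hk⟩ := hx
      rw [mem_PF]
      interval_cases c <;> simp [sizeO] at hi <;> simp only [mapO] <;> (try split_ifs) <;>
        simp [InP] <;> omega
    · rintro ⟨c, i, k⟩ hx ⟨c', i', k'⟩ hx' h
      rw [mem_idx] at hx hx'
      obtain ⟨hc, hi, hk⟩ := hx
      obtain ⟨hc', hi', hk'⟩ := hx'
      obtain ⟨j, rfl⟩ := Nat.exists_eq_add_of_le hk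
      obtain ⟨j', rfl⟩ := Nat.exists_eq_add_of_le hk'
      clear hk hk'
      interval_cases c <;> interval_cases c' <;>
       simp only [mapO, Nat.add_sub_cancel_left, add_eq_zero] at h <;>
       (try split_ifs at h) <;>
       (try simp only [Prod.mk.injEq, OfNat.ofNat_ne_zero, OfNat.zero_ne_ofNat, zero_ne_one, one_ne_zero,
         false_and, and_false, true_and, and_true, Nat.reduceEqDiff, OfNat.ofNat_ne_one,
         OfNat.one_ne_ofNat] at h) <;>
       simp only [sizeO] at hi hi' <;> norm_num at hi hi' <;>
       (first | (apply sig_ext <;> omega) | (exfalso; omega))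
    · rintro ⟨s, p, k, t⟩ hx
      rw [mem_PF] at hx
      simp only [InP] at hx
      have fin : ∀ c i k', c < 9 → i < sizeO m c → k' ≤ i → mapO (2 * m + 1) ⟨c, i, k'⟩ = (s, p, k, t) →
        ∃ a, ∃ (_ : a ∈ (Finset.range 9).sigma (fun c => tri (sizeO m c))), mapO (2 * m + 1) a = (s, p, k, t) :=
        fun c i k' h1 h2 h3 h4 => ⟨⟨c, i, k'⟩, (mem_idx _ _ _ _ _).2 ⟨h1, h2, h3⟩, h4⟩
      rcases hx with ⟨rfl, ⟨rfl, h⟩ | ⟨rfl, rfl, h⟩ | ⟨rfl, rfl, h⟩ | ⟨h0, rfl, h, h', h''⟩ | ⟨h0, rfl, h, h'⟩ |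
        ⟨h0, rfl, h, h', h''⟩⟩ | ⟨rfl, h1, ⟨rfl, rfl, h⟩ | ⟨h2, ⟨rfl, h⟩ | ⟨rfl, rfl, h⟩ | ⟨h0, rfl, h, h'⟩ |
        ⟨h0, rfl, h, h'⟩ | ⟨h0, rfl, h, h'⟩⟩⟩
      · rcases Nat.mod_two_eq_zero_or_one p with hp | hp
        · exact fin 0 (p / 2 + k) k (by norm_num) (by norm_num [sizeO] <;> omega) (by omega) (by simp only [mapO, Prod.mk.injEq, if_true, true_and, and_true] <;> omega)
        · exact fin 1 (p / 2 + k) k (by norm_num) (by norm_num [sizeO] <;> omega) (by omega) (by simp only [mapO, Prod.mk.injEq, if_true, true_and, and_true] <;> omega)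
      · exact fin 2 0 0 (by norm_num) (by norm_num [sizeO] <;> omega) (by omega) (by simp only [mapO, Prod.mk.injEq, if_true, true_and, and_true] <;> omega)
      · exact fin 3 0 0 (by norm_num) (by norm_num [sizeO] <;> omega) (by omega) (by simp only [mapO, Prod.mk.injEq, if_true, true_and, and_true] <;> omega)
      · exact fin 4 (p / 2 + k - 1) (k - 1) (by norm_num) (by norm_num [sizeO] <;> omega) (by omega) (by simp only [mapO, Prod.mk.injEq, if_true, true_and, and_true] <;> omega)
      · exact fin 5 (p / 2 + k - 1) (k - 1) (by norm_num) (by norm_num [sizeO] <;> omega) (by omega) (by simp only [mapO, Prod.mk.injEq, if_true, true_and, and_true] <;> omega)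
      · apply fin 6 (p / 2 + k - 1) (k - 1)
        · omega
        · simp [sizeO]; omega
        · omega
        · simp only [mapO]; rw [if_neg (by omega)]; simp only [Prod.mk.injEq, true_and, and_true]; omega
      · exact fin 6 0 0 (by norm_num) (by norm_num [sizeO] <;> omega) (by omega) (by simp only [mapO, Prod.mk.injEq, if_true, true_and, and_true] <;> omega)
      · exact fin 7 (p / 2 + k - 1) k (by norm_num) (by norm_num [sizeO] <;> omega) (by omega) (by simp only [mapO, Prod.mk.injEq, if_true, true_and, and_true] <;> omega)
      · omega
      · exact fin 8 (p / 2 + k - 2) (k - 1) (by norm_num) (by norm_num [sizeO] <;> omega) (by omega) (by simp only [mapO, Prod.mk.injEq, if_true, true_and, and_true] <;> omega)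
      · omega
      · omega
  rw [← key, Finset.card_sigma]
  have h0 := two_card_tri m
  have h1 := two_card_tri (m - 1)
  have h3 := two_card_tri 1
  simp only [Finset.sum_range_succ, Finset.sum_range_zero]
  simp [sizeO]
  rcases m with _ | r
  · simp [tri]
  · have e1 : r + 1 - 1 = r := by omega
    rw [e1] at h1 ⊢
    nlinarith

abbrev W4 := ℕ → Fin 4

def fA : W4 → W4 := autTrans a4Tr a4Out 0
def fB : W4 → W4 := autTrans a4Tr a4Out 1

def tailF : ℕ → W4 → W4
  | 0 => id
  | 1 => fA
  | 2 => fA ∘ fA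
  | _ => fB

def el (s p k t : ℕ) (u : W4) : W4 := fA^[s] (fB^[p] ((fA ∘ fB)^[k] (tailF t u)))

theorem stA (u : W4) (n : ℕ) : stateSeq a4Tr 0 u n = 0 := by
  induction n with
  | zero => rfl
  | succ n ih => simp [stateSeq, ih, a4Tr]

theorem fA_apply (u : W4) (n : ℕ) : fA u n = a4Out (u n) 0 := by
  simp [fA, autTrans, stA]

theorem stB (u : W4) (n : ℕ) (h : ∀ i < n, u i ≠ 0) : stateSeq a4Tr 1 u n = 1 := by
  induction n with
  | zero => rfl
  | succ n ih =>
    simp [stateSeq, ih (fun i hi => h i (by omega)), a4Tr, h n (by omega)]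

theorem stB' (u : W4) (k n : ℕ) (h0 : u k = 0) (hn : k < n) : stateSeq a4Tr 1 u n = 0 := by
  induction n with
  | zero => omega
  | succ n ih =>
    simp only [stateSeq]
    rcases Nat.lt_or_ge k n with h | h
    · simp [ih h, a4Tr]
    · have : k = n := by omega
      subst this
      simp [h0, a4Tr]

theorem fB_le (u : W4) (n : ℕ) (h : ∀ i < n, u i ≠ 0) : fB u n = a4Out (u n) 1 := by
  simp [fB, autTrans, stB u n h]

theorem fB_gt (u : W4) (k n : ℕ) (h0 : u k = 0) (hn : k < n) : fB u n = a4Out (u n) 0 := by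
  simp [fB, autTrans, stB' u k n h0 hn]

/-! ### bisimulation -/
def stepW : List (Fin 2) → Fin 4 → List (Fin 2) × Fin 4
  | [], x => ([], x)
  | q :: w, x =>
    let r := stepW w x
    (a4Tr r.2 q :: r.1, a4Out r.2 q)

theorem aut_succ (q : Fin 2) (u : W4) :
    (fun n => autTrans a4Tr a4Out q u (n + 1)) =
      autTrans a4Tr a4Out (a4Tr (u 0) q) (fun n => u (n + 1)) := by
  have : ∀ n, stateSeq a4Tr q u (n + 1) = stateSeq a4Tr (a4Tr (u 0) q) (fun n => u (n + 1)) n := by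
    intro n
    induction n with
    | zero => rfl
    | succ n ih => rw [stateSeq, ih]; rfl
  funext n
  simp [autTrans, this]

theorem wt_cons (q : Fin 2) (w : List (Fin 2)) (u : W4) :
    wordTrans a4Tr a4Out (q :: w) u = autTrans a4Tr a4Out q (wordTrans a4Tr a4Out w u) := rfl

theorem wt_step (w : List (Fin 2)) (u : W4) :
    wordTrans a4Tr a4Out w u 0 = (stepW w (u 0)).2 ∧
    (fun n => wordTrans a4Tr a4Out w u (n + 1)) =
      wordTrans a4Tr a4Out (stepW w (u 0)).1 (fun n => u (n + 1)) := by
  induction w with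
  | nil => exact ⟨rfl, rfl⟩
  | cons q w ih =>
    constructor
    · rw [wt_cons]; simp [autTrans, stateSeq, stepW, ih.1]
    · rw [wt_cons, aut_succ, ih.1, ih.2]; rfl

theorem bisim (R : List (List (Fin 2) × List (Fin 2)))
    (hR : ∀ p ∈ R, ∀ x, (stepW p.1 x).2 = (stepW p.2 x).2 ∧
      ((stepW p.1 x).1, (stepW p.2 x).1) ∈ R) (p : List (Fin 2) × List (Fin 2)) (hp : p ∈ R)
      (u : W4) :
    wordTrans a4Tr a4Out p.1 u = wordTrans a4Tr a4Out p.2 u := by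
  funext n
  induction n generalizing p u with
  | zero => rw [(wt_step _ _).1, (wt_step _ _).1]; exact (hR p hp _).1
  | succ n ih =>
    have h1 := congrFun (wt_step p.1 u).2 n
    have h2 := congrFun (wt_step p.2 u).2 n

    rw [h1, h2]
    exact ih _ (hR p hp _).2 _

/-! ### relations -/
theorem aa_const (u : W4) : fA (fA u) = fun _ => 0 := by
  funext n
  simp only [fA_apply]
  generalize u n = x
  revert x; decide

theorem rel4 (u : W4) : fB (fA (fB (fB (fB u)))) = fB (fA (fB u)) :=
  bisim [([1, 0, 1, 1, 1], [1, 0, 1]), ([1, 0, 0, 1, 0], [1, 0, 0]), ([0, 0, 1, 0, 1], [0, 0, 1]),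
    ([0, 0, 1, 1, 1], [0, 0, 1]), ([0, 0, 0, 0, 0], [0, 0, 0]), ([0, 0, 0, 1, 0], [0, 0, 0]),
    ([0, 0, 1, 0, 0], [0, 0, 0]), ([0, 0, 0, 0, 1], [0, 0, 1])] (by decide)
    ([1, 0, 1, 1, 1], [1, 0, 1]) (by decide) u

theorem rel3 (u : W4) : fB (fA (fB (fB (fA u)))) = fB (fA (fA u)) :=
  bisim [([1, 0, 1, 1, 0], [1, 0, 0]), ([0, 0, 1, 0, 0], [0, 0, 0]), ([0, 0, 1, 1, 0], [0, 0, 0]),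
    ([0, 0, 0, 0, 0], [0, 0, 0])] (by decide)
    ([1, 0, 1, 1, 0], [1, 0, 0]) (by decide) u

/-- words `3^k 2 {0,1}^ω` -/
def YY (k : ℕ) (y : W4) : Prop := (∀ i < k, y i = 3) ∧ y k = 2 ∧ ∀ i > k, y i = 0 ∨ y i = 1

theorem YY_bb (k : ℕ) (y : W4) (h : YY k y) : YY k (fB (fB y)) := by
  obtain ⟨h1, h2, h3⟩ := h
  have e1 : ∀ i < k, fB y i = 1 := by
    intro i hi
    rw [fB_le _ _ (fun j hj => by rw [h1 j (by omega)]; decide), h1 i hi]; decide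
  have e2 : fB y k = 0 := by
    rw [fB_le _ _ (fun j hj => by rw [h1 j (by omega)]; decide), h2]; decide
  refine ⟨?_, ?_, ?_⟩
  · intro i hi
    rw [fB_le _ _ (fun j hj => by rw [e1 j (by omega)]; decide), e1 i hi]; decide
  · rw [fB_le _ _ (fun j hj => by rw [e1 j (by omega)]; decide), e2]; decide
  · intro i hi
    rw [fB_gt _ k _ e2 hi]
    generalize fB y i = x
    revert x; decide

theorem YY_a (k : ℕ) (y : W4) (h : YY k y) : fA y = fun n => if n ≤ k then 1 else 0 := by
  obtain ⟨h1, h2, h3⟩ := h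
  funext n
  rw [fA_apply]
  rcases lt_trichotomy n k with h | h | h
  · rw [h1 n h, if_pos h.le]; decide
  · subst h; rw [h2, if_pos le_rfl]; decide
  · rw [if_neg (by omega)]
    rcases h3 n h with h | h <;> rw [h] <;> decide

theorem YY_iter (k : ℕ) (y : W4) (h : YY k y) (j : ℕ) : YY k (fB^[2 * j] y) := by
  induction j with
  | zero => exact h
  | succ j ih =>
    rw [show 2 * (j + 1) = (2 * j + 1) + 1 by ring, Function.iterate_succ_apply',
      Function.iterate_succ_apply']
    exact YY_bb _ _ ih

theorem fB_one : fB (fun _ => 1) = fun _ => 3 := by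
  funext n; rw [fB_le _ _ (fun j hj => by decide)]; decide
theorem fB_three : fB (fun _ => 3) = fun _ => 1 := by
  funext n; rw [fB_le _ _ (fun j hj => by decide)]; decide
theorem fB_two : fB (fun _ => 2) = fun _ => 0 := by
  funext n; rw [fB_le _ _ (fun j hj => by decide)]; decide
theorem fA_zero : fA (fun _ => 0) = fun _ => 0 := by
  funext n; rw [fA_apply]; decide
theorem fA_one : fA (fun _ => 1) = fun _ => 0 := by
  funext n; rw [fA_apply]; decide
theorem fA_two : fA (fun _ => 2) = fun _ => 1 := by
  funext n; rw [fA_apply]; decide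
theorem fA_three : fA (fun _ => 3) = fun _ => 1 := by
  funext n; rw [fA_apply]; decide

theorem iter_odd_three (j : ℕ) : fB^[2 * j] (fun _ => 3) = fun _ => 3 := by
  induction j with
  | zero => rfl
  | succ j ih =>
    rw [show 2 * (j + 1) = (2 * j + 1) + 1 by ring, Function.iterate_succ_apply',
      Function.iterate_succ_apply', ih, fB_three, fB_one]

theorem rel2 (p : ℕ) (hp : p % 2 = 1) (u : W4) : fA (fB^[p] (fA u)) = fA (fB (fA u)) := by
  obtain ⟨j, rfl⟩ : ∃ j, p = 2 * j + 1 := ⟨p / 2, by omega⟩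
  rw [Function.iterate_succ_apply]
  have h01 : ∀ n, fA u n = 0 ∨ fA u n = 1 := by
    intro n; rw [fA_apply]; generalize u n = x; revert x; decide
  generalize fA u = v at h01
  by_cases hz : ∃ k, v k = 0
  · obtain ⟨k, hk, hmin⟩ : ∃ k, v k = 0 ∧ ∀ i < k, v i ≠ 0 := by
      classical
      exact ⟨Nat.find hz, Nat.find_spec hz, fun i hi => Nat.find_min hz hi⟩
    have hY : YY k (fB v) := by
      refine ⟨?_, ?_, ?_⟩
      · intro i hi
        have : v i = 1 := (h01 i).resolve_left (hmin i hi)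
        rw [fB_le _ _ (fun j hj => hmin j (by omega)), this]; decide
      · rw [fB_le _ _ hmin, hk]; decide
      · intro i hi
        rw [fB_gt _ k _ hk hi]
        generalize v i = x
        revert x; decide
    rw [YY_a _ _ (YY_iter k _ hY j), YY_a _ _ hY]
  · push Not at hz
    have : v = fun _ => 1 := by funext n; exact (h01 n).resolve_left (hz n)
    rw [this, fB_one, iter_odd_three]

theorem rel4_iter (p : ℕ) (u : W4) :
    fB (fA (fB^[p + 1] u)) = if p % 2 = 0 then fB (fA (fB u)) else fB (fA (fB (fB u))) := by
  induction p using Nat.strong_induction_on with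
  | _ p ih =>
    match p with
    | 0 => rfl
    | 1 => rfl
    | p + 2 =>
      have := ih p (by omega)
      rw [show p + 2 + 1 = p + 1 + 1 + 1 by ring, Function.iterate_succ_apply',
        Function.iterate_succ_apply', Function.iterate_succ_apply', rel4,
        ← Function.iterate_succ_apply' fB, this]
      simp

/-! ### el -/
theorem el_s1 (p k t : ℕ) (u : W4) : el 1 p k t u = fA (el 0 p k t u) := rfl

theorem el_p (p k t : ℕ) (u : W4) : el 0 (p + 1) k t u = fB (el 0 p k t u) := by
  simp only [el, Function.iterate_succ_apply', Function.iterate_zero, id]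

theorem el_k (k t : ℕ) (u : W4) : el 0 0 (k + 1) t u = fA (fB (el 0 0 k t u)) := by
  simp only [el, Function.iterate_succ_apply', Function.iterate_zero, id, Function.comp]

/-- elements with `p = 0` and starting with `a` -/
theorem el_startA (k t : ℕ) (h : 1 ≤ k ∨ t = 1 ∨ t = 2) (u : W4) : ∃ v, el 0 0 k t u = fA v := by
  rcases k with _ | k
  · rcases h with h | rfl | rfl
    · omega
    · exact ⟨u, rfl⟩
    · exact ⟨fA u, rfl⟩
  · exact ⟨_, el_k _ _ _⟩

theorem el_eq (p k t : ℕ) (u : W4) : el 0 p k t u = fB^[p] (el 0 0 k t u) := rfl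

theorem el_aa (u : W4) : el 0 0 0 2 u = fun _ => 0 := aa_const u

/-! ### closure -/
theorem upB (n s p k t : ℕ) (h : InP n s p k t) :
    ∃ s' p' k' t', InP (n + 1) s' p' k' t' ∧ ∀ u, fB (el s p k t u) = el s' p' k' t' u := by
  have hs : s = 0 ∨ s = 1 := by rcases h with h | h <;> omega
  rcases hs with rfl | rfl
  · refine ⟨0, p + 1, k, t, ?_, fun u => (el_p p k t u).symm⟩
    rcases h with ⟨_, ⟨rfl, h⟩ | ⟨rfl, rfl, h⟩ | ⟨rfl, rfl, h⟩ | ⟨h0, rfl, h, h', h''⟩ | ⟨h0, rfl, h, h'⟩ |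
        ⟨h0, rfl, h, h', h''⟩⟩ | ⟨h, _⟩
    · simp [InP]; omega
    · simp [InP]; omega
    · simp [InP]; omega
    · simp [InP]; omega
    · simp [InP]; omega
    · simp [InP]; omega
    · omega
  · have hp : 2 ≤ p := by rcases h with h | h <;> omega
    obtain ⟨r, rfl⟩ : ∃ r, p = r + 1 := ⟨p - 1, by omega⟩
    by_cases hk : k = 0 ∧ t = 0
    · obtain ⟨rfl, rfl⟩ := hk
      have hn : n = r + 2 := by
        simp [InP] at h; omega
      have e : ∀ u, fB (el 1 (r + 1) 0 0 u) = fB (fA (fB^[r + 1] u)) := fun u => rfl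
      rcases Nat.mod_two_eq_zero_or_one r with hr | hr
      · refine ⟨0, 1, 1, 0, ?_, fun u => ?_⟩
        · simp [InP]; omega
        · rw [e, rel4_iter, if_pos hr]; rfl
      · refine ⟨0, 1, 1, 3, ?_, fun u => ?_⟩
        · simp [InP]; omega
        · rw [e, rel4_iter, if_neg (by omega)]; rfl
    · have hst : 1 ≤ k ∨ t = 1 ∨ t = 2 := by rcases h with h | h <;> omega
      have hr : r % 2 = 1 := by rcases h with h | h <;> omega
      refine ⟨0, 1, 0, 2, ?_, fun u => ?_⟩
      · have : 3 ≤ n := by rcases h with h | h <;> omega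
        simp [InP]; omega
      · obtain ⟨v, hv⟩ := el_startA k t hst u
        rw [el_s1, el_eq, hv, rel4_iter, if_neg (by omega), rel3, el_p, el_aa, aa_const]

theorem upA (n s p k t : ℕ) (hn : 1 ≤ n) (h : InP n s p k t) :
    ∃ s' p' k' t', InP (n + 1) s' p' k' t' ∧ ∀ u, fA (el s p k t u) = el s' p' k' t' u := by
  have hs : s = 0 ∨ s = 1 := by rcases h with h | h <;> omega
  have hAA : InP (n + 1) 0 0 0 2 := by simp [InP]; omega
  rcases hs with rfl | rfl
  · by_cases hk : k = 0 ∧ t = 0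
    · obtain ⟨rfl, rfl⟩ := hk
      have hp : p = n := by simp [InP] at h; omega
      by_cases h1 : p = 1
      · subst h1
        refine ⟨0, 0, 1, 0, ?_, fun u => rfl⟩
        simp [InP]; omega
      · refine ⟨1, p, 0, 0, ?_, fun u => rfl⟩
        simp [InP]; omega
    · have hst : 1 ≤ k ∨ t = 1 ∨ t = 2 := by rcases h with h | h <;> omega
      by_cases h0 : p = 0
      · subst h0
        refine ⟨0, 0, 0, 2, hAA, fun u => ?_⟩
        obtain ⟨v, hv⟩ := el_startA k t hst u
        rw [hv, el_aa, aa_const]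
      · rcases Nat.mod_two_eq_zero_or_one p with hp | hp
        · refine ⟨1, p, k, t, ?_, fun u => rfl⟩
          rcases h with ⟨_, ⟨rfl, h⟩ | ⟨rfl, rfl, h⟩ | ⟨rfl, rfl, h⟩ | ⟨h0, rfl, h, h', h''⟩ |
            ⟨h0, rfl, h, h'⟩ | ⟨h0, rfl, h, h', h''⟩⟩ | ⟨h, _⟩
          · simp [InP]; omega
          · omega
          · simp [InP]; omega
          · simp [InP]; omega
          · simp [InP]; omega
          · simp [InP]; omega
          · omega
        · refine ⟨0, 0, k + 1, t, ?_, fun u => ?_⟩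
          · rcases h with ⟨_, ⟨rfl, h⟩ | ⟨rfl, rfl, h⟩ | ⟨rfl, rfl, h⟩ | ⟨h0, rfl, h, h', h''⟩ |
              ⟨h0, rfl, h, h'⟩ | ⟨h0, rfl, h, h', h''⟩⟩ | ⟨h, _⟩
            · simp [InP]; omega
            · omega
            · simp [InP]; omega
            · simp [InP]; omega
            · simp [InP]; omega
            · simp [InP]; omega
            · omega
          · obtain ⟨v, hv⟩ := el_startA k t hst u
            rw [el_eq, el_k, hv, rel2 p hp]
  · exact ⟨0, 0, 0, 2, hAA, fun u => by rw [el_s1, aa_const, el_aa]⟩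

theorem down (n s p k t : ℕ) (hn : 1 ≤ n) (h : InP (n + 1) s p k t) :
    ∃ s' p' k' t', InP n s' p' k' t' ∧
      ((∀ u, el s p k t u = fA (el s' p' k' t' u)) ∨ (∀ u, el s p k t u = fB (el s' p' k' t' u))) := by
  have hs : s = 0 ∨ s = 1 := by rcases h with h | h <;> omega
  rcases hs with rfl | rfl
  · rcases p with _ | r
    · -- p = 0
      rcases k with _ | k
      · have ht : t = 2 := by
          rcases h with h | h <;> omega
        subst ht
        by_cases h1 : n = 1
        · subst h1
          exact ⟨0, 0, 0, 1, by simp [InP], Or.inl fun u => rfl⟩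
        · refine ⟨0, 0, 0, 2, by simp [InP]; omega, Or.inl fun u => ?_⟩
          rw [el_aa, fA_zero]
      · have e : ∀ u, el 0 0 (k + 1) t u = fA (el 0 1 k t u) := fun u => by rw [el_k, ← el_p]
        rcases h with ⟨_, ⟨rfl, h⟩ | ⟨h0, rfl, h⟩ | ⟨h0, rfl, h⟩ | ⟨h0, rfl, h, h', h''⟩ |
            ⟨h0, rfl, h, h'⟩ | ⟨h0, rfl, h, h', h''⟩⟩ | ⟨h, _⟩
        · exact ⟨0, 1, k, 2, by simp [InP]; omega, Or.inl e⟩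
        · omega
        · omega
        · exact ⟨0, 1, k, 0, by simp [InP]; omega, Or.inl e⟩
        · by_cases hk : k = 0
          · subst hk
            refine ⟨0, n - 1, 0, 1, by simp [InP]; omega, Or.inl fun u => ?_⟩
            have : el 0 (n - 1) 0 1 u = fB^[n - 1] (fA u) := rfl
            rw [this, rel2 _ (by omega)]
            rfl
          · exact ⟨0, 1, k, 1, by simp [InP]; omega, Or.inl e⟩
        · exact ⟨0, 1, k, 3, by simp [InP]; omega, Or.inl e⟩
        · omega
    · by_cases hx : r = 0 ∧ k = 1 ∧ (t = 3 ∨ (t = 0 ∧ n ≠ 2))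
      · obtain ⟨rfl, rfl, ht⟩ := hx
        have hn3 : 3 ≤ n := by rcases h with h | h <;> omega
        refine ⟨1, n - 1, 0, 0, by simp [InP]; omega, Or.inr fun u => ?_⟩
        have e : fB (el 1 (n - 1) 0 0 u) = fB (fA (fB^[(n - 2) + 1] u)) := by
          rw [show n - 2 + 1 = n - 1 by omega]; rfl
        rw [e, rel4_iter]
        rcases ht with rfl | ⟨rfl, _⟩
        · rw [if_neg]
          · rfl
          · simp [InP] at h; omega
        · rw [if_pos]
          · rfl
          · simp [InP] at h; omega
      · refine ⟨0, r, k, t, ?_, Or.inr fun u => el_p _ _ _ _⟩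
        rcases h with ⟨_, ⟨rfl, h⟩ | ⟨rfl, rfl, h⟩ | ⟨rfl, rfl, h⟩ | ⟨h0, rfl, h, h', h''⟩ | ⟨h0, rfl, h, h'⟩ |
            ⟨h0, rfl, h, h', h''⟩⟩ | ⟨h, _⟩
        · simp [InP]; omega
        · simp [InP]; omega
        · simp [InP]; omega
        · simp [InP]; omega
        · simp [InP]; omega
        · simp [InP]; omega
        · omega
  · refine ⟨0, p, k, t, ?_, Or.inl fun u => rfl⟩
    rcases h with ⟨h, _⟩ | ⟨_, h1, ⟨rfl, rfl, h⟩ | ⟨h2, ⟨rfl, h⟩ | ⟨rfl, rfl, h⟩ | ⟨h0, rfl, h, h'⟩ |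
        ⟨h0, rfl, h, h'⟩ | ⟨h0, rfl, h, h'⟩⟩⟩
    · omega
    · simp [InP]; omega
    · simp [InP]; omega
    · simp [InP]; omega
    · simp [InP]; omega
    · simp [InP]; omega
    · simp [InP]; omega

def elX (x : ℕ × ℕ × ℕ × ℕ) : W4 → W4 := el x.1 x.2.1 x.2.2.1 x.2.2.2

theorem reach_eq (n : ℕ) :
    { g : W4 → W4 | ∃ w : List (Fin 2), w.length = n + 1 ∧ wordTrans a4Tr a4Out w = g } =
      elX '' (PF (n + 1) : Set (ℕ × ℕ × ℕ × ℕ)) := by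
  induction n with
  | zero =>
    ext g
    constructor
    · rintro ⟨w, hw, rfl⟩
      obtain ⟨q, rfl⟩ := List.length_eq_one_iff.1 hw
      fin_cases q
      · exact ⟨(0, 0, 0, 1), by rw [Finset.mem_coe, mem_PF]; simp [InP], rfl⟩
      · exact ⟨(0, 1, 0, 0), by rw [Finset.mem_coe, mem_PF]; simp [InP], rfl⟩
    · rintro ⟨⟨s, p, k, t⟩, hx, rfl⟩
      rw [Finset.mem_coe, mem_PF] at hx
      have : (s = 0 ∧ p = 0 ∧ k = 0 ∧ t = 1) ∨ (s = 0 ∧ p = 1 ∧ k = 0 ∧ t = 0) := by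
        rcases hx with h | h <;> simp only at h <;> omega
      rcases this with ⟨rfl, rfl, rfl, rfl⟩ | ⟨rfl, rfl, rfl, rfl⟩
      · exact ⟨[0], rfl, rfl⟩
      · exact ⟨[1], rfl, rfl⟩
  | succ n ih =>
    ext g
    constructor
    · rintro ⟨w, hw, rfl⟩
      rcases w with _ | ⟨q, w⟩
      · simp at hw
      · have hm : wordTrans a4Tr a4Out w ∈ elX '' (PF (n + 1) : Set (ℕ × ℕ × ℕ × ℕ)) := by
          rw [← ih]; exact ⟨w, by simpa using hw, rfl⟩
        obtain ⟨⟨s, p, k, t⟩, hx, he⟩ := hm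
        rw [Finset.mem_coe, mem_PF] at hx
        have hq : q = 0 ∨ q = 1 := by omega
        rcases hq with rfl | rfl
        · obtain ⟨s', p', k', t', h1, h2⟩ := upA _ _ _ _ _ (by omega) hx
          refine ⟨(s', p', k', t'), by rw [Finset.mem_coe, mem_PF]; exact h1, ?_⟩
          funext u
          rw [wt_cons, ← he]
          exact (h2 u).symm
        · obtain ⟨s', p', k', t', h1, h2⟩ := upB _ _ _ _ _ hx
          refine ⟨(s', p', k', t'), by rw [Finset.mem_coe, mem_PF]; exact h1, ?_⟩
          funext u
          rw [wt_cons, ← he]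
          exact (h2 u).symm
    · rintro ⟨⟨s, p, k, t⟩, hx, rfl⟩
      rw [Finset.mem_coe, mem_PF] at hx
      obtain ⟨s', p', k', t', h1, h2⟩ := down _ _ _ _ _ (by omega) hx
      have hm : elX (s', p', k', t') ∈ elX '' (PF (n + 1) : Set (ℕ × ℕ × ℕ × ℕ)) :=
        ⟨_, by rw [Finset.mem_coe, mem_PF]; exact h1, rfl⟩
      rw [← ih] at hm
      obtain ⟨w, hw, he⟩ := hm
      rcases h2 with h2 | h2
      · refine ⟨0 :: w, by simp [hw], ?_⟩
        funext u
        rw [wt_cons, he]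
        exact (h2 u).symm
      · refine ⟨1 :: w, by simp [hw], ?_⟩
        funext u
        rw [wt_cons, he]
        exact (h2 u).symm

/-! ### values -/
def VV (p k : ℕ) : W4 := fun n =>
  if p = 0 then (if n < k then 1 else 0)
  else if p % 2 = 1 then (if n < k then 3 else if n = k then 2 else if n ≤ k + p / 2 then 1 else 0)
  else (if n < k then 1 else if n = k then 0 else if n < k + p / 2 then 3 else
    if n = k + p / 2 then 2 else 0)

theorem VV_zero (k n : ℕ) : VV 0 k n = if n < k then 1 else 0 := by simp [VV]
theorem VV_odd (p k n : ℕ) (hp : p % 2 = 1) :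
    VV p k n = if n < k then 3 else if n = k then 2 else if n ≤ k + p / 2 then 1 else 0 := by
  have : p ≠ 0 := by omega
  simp [VV, this, hp]
theorem VV_even (p k n : ℕ) (hp : p % 2 = 0) (h2 : 2 ≤ p) :
    VV p k n = if n < k then 1 else if n = k then 0 else if n < k + p / 2 then 3 else
    if n = k + p / 2 then 2 else 0 := by
  have : p ≠ 0 := by omega
  simp [VV, this, hp]

theorem fB_first (u v : W4) (z : ℕ) (h0 : u z = 0) (hlt : ∀ i < z, u i ≠ 0)
    (h1 : ∀ n ≤ z, a4Out (u n) 1 = v n) (h2 : ∀ n, z < n → a4Out (u n) 0 = v n) : fB u = v := by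
  funext n
  rcases Nat.lt_or_ge z n with h | h
  · rw [fB_gt u z n h0 h, h2 n h]
  · rw [fB_le u n (fun i hi => hlt i (by omega)), h1 n h]

theorem fB_VV (p k : ℕ) : fB (VV p k) = VV (p + 1) k := by
  rcases Nat.eq_zero_or_pos p with rfl | hp
  · apply fB_first _ _ k
    · simp [VV_zero]
    · intro i hi; simp [VV_zero, hi]
    · intro n hn; rw [VV_zero, VV_odd _ _ _ (by omega)]
      split_ifs <;> first | omega | decide
    · intro n hn; rw [VV_zero, VV_odd _ _ _ (by omega)]
      split_ifs <;> first | omega | decide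
  · rcases Nat.mod_two_eq_zero_or_one p with h | h
    · apply fB_first _ _ k
      · rw [VV_even _ _ _ h (by omega)]; simp
      · intro i hi; rw [VV_even _ _ _ h (by omega)]; simp [hi]
      · intro n hn; rw [VV_even _ _ _ h (by omega), VV_odd _ _ _ (by omega)]
        split_ifs <;> first | omega | decide
      · intro n hn; rw [VV_even _ _ _ h (by omega), VV_odd _ _ _ (by omega)]
        split_ifs <;> first | omega | decide
    · apply fB_first _ _ (k + p / 2 + 1)
      · rw [VV_odd _ _ _ h]; split_ifs <;> first | omega | decide
      · intro i hi; rw [VV_odd _ _ _ h]; split_ifs <;> first | omega | decide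
      · intro n hn; rw [VV_odd _ _ _ h, VV_even _ _ _ (by omega) (by omega)]
        split_ifs <;> first | omega | decide
      · intro n hn; rw [VV_odd _ _ _ h, VV_even _ _ _ (by omega) (by omega)]
        split_ifs <;> first | omega | decide

theorem VV_iter (p k : ℕ) : fB^[p] (VV 0 k) = VV p k := by
  induction p with
  | zero => rfl
  | succ p ih => rw [Function.iterate_succ_apply', ih, fB_VV]

theorem fAB_VV (k : ℕ) : fA (fB (VV 0 k)) = VV 0 (k + 1) := by
  rw [fB_VV]
  funext n
  rw [fA_apply, VV_odd _ _ _ (by omega), VV_zero]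
  split_ifs <;> first | omega | decide

theorem VV00 : VV 0 0 = fun _ => 0 := by funext n; simp [VV_zero]

theorem fAB_iter (k j : ℕ) : (fA ∘ fB)^[k] (VV 0 j) = VV 0 (j + k) := by
  induction k with
  | zero => rfl
  | succ k ih => rw [Function.iterate_succ_apply', ih, Function.comp_apply, fAB_VV]; rfl

theorem fAB_iter_one (k : ℕ) : (fA ∘ fB)^[k] (fun _ => 1) = fun _ => 1 := by
  induction k with
  | zero => rfl
  | succ k ih => rw [Function.iterate_succ_apply', ih, Function.comp_apply, fB_one, fA_three]

/-- `b` cannot see what follows when it is in `{0,1}` after a first zero. -/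
theorem b_kill : fB (fA (fB (fB (fun _ => 0)))) = fB (fun _ => 0) := by
  have := rel3 (fun _ => 0)
  rwa [fA_zero, fA_zero] at this

theorem el_zero_zero (s p k t : ℕ) (u : W4) (j : ℕ) (h : tailF t u = VV 0 j) :
    el s p k t u = fA^[s] (VV p (j + k)) := by
  rw [el, h, fAB_iter, VV_iter]

theorem el_par (s p k t : ℕ) (u : W4) (h : tailF t u = fun _ => 1) :
    el s p k t u = fA^[s] (fB^[p] (fun _ => 1)) := by
  rw [el, h, fAB_iter_one]

/-- value at `0` for `t = 3` -/
theorem el_three_zero (s p k : ℕ) (h : p ≠ 0 ∨ k ≠ 0) :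
    el s p (k + 1) 3 (fun _ => 0) = fA^[s] (VV p k) := by
  have key : fB^[p] ((fA ∘ fB)^[k] (fA (fB (fB (fun _ => 0))))) = VV p k := by
    rcases k with _ | k
    · obtain ⟨r, rfl⟩ : ∃ r, p = r + 1 := ⟨p - 1, by omega⟩
      rw [Function.iterate_succ_apply, Function.iterate_zero, id, b_kill, ← VV00,
        ← Function.iterate_succ_apply, VV_iter]
    · rw [Function.iterate_succ_apply, Function.comp_apply, b_kill, ← VV00, fAB_VV, fAB_iter,
        VV_iter, Nat.add_comm]
  rw [el, Function.iterate_succ_apply]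
  exact congrArg _ key

theorem el_k_succ (s p k t : ℕ) (u : W4) (j : ℕ) (h : fA (fB (tailF t u)) = VV 0 j) :
    el s p (k + 1) t u = fA^[s] (VV p (j + k)) := by
  rw [el, Function.iterate_succ_apply, Function.comp_apply, h, fAB_iter, VV_iter]

/-! ### injectivity of values -/
set_option maxHeartbeats 8000000 in
theorem VV_inj (p k p' k' : ℕ) (h : VV p k = VV p' k') : p = p' ∧ k = k' := by
  wlog hw : (p = 0) ∨ (p % 2 = 1 ∧ p' ≠ 0) ∨ (p % 2 = 0 ∧ p' % 2 = 0 ∧ p' ≠ 0) generalizing p k p' k' with H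
  · have := H p' k' p k h.symm (by omega)
    omega
  have h := congrFun h
  by_cases hp : p = 0
  · subst hp
    by_cases hp' : p' = 0
    · subst hp'
      have h1 := h k
      have h2 := h k'
      simp only [VV_zero] at h1 h2
      split_ifs at h1 <;> first | omega | (split_ifs at h2 <;> omega)
    · exfalso
      rcases Nat.mod_two_eq_zero_or_one p' with h' | h'
      · have h1 := h (k' + p' / 2)
        rw [VV_zero, VV_even _ _ _ h' (by omega)] at h1
        split_ifs at h1 <;> omega
      · have h1 := h k'
        rw [VV_zero, VV_odd _ _ _ h'] at h1
        split_ifs at h1 <;> omega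
  · rcases Nat.mod_two_eq_zero_or_one p with hm | hm
    · have hm' : p' % 2 = 0 := by omega
      have hk : k = k' := by
        have h1 := h k
        have h2 := h k'
        rw [VV_even _ _ _ hm (by omega), VV_even _ _ _ hm' (by omega)] at h1 h2
        split_ifs at h1 <;> first | omega | (split_ifs at h2 <;> omega)
      subst hk
      have h1 := h (k + p / 2)
      have h2 := h (k + p' / 2)
      rw [VV_even _ _ _ hm (by omega), VV_even _ _ _ hm' (by omega)] at h1 h2
      split_ifs at h1 <;> first | omega | (split_ifs at h2 <;> omega)
    · rcases Nat.mod_two_eq_zero_or_one p' with hm' | hm'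
      · exfalso
        have h1 := h k
        have h2 := h k'
        rw [VV_odd _ _ _ hm, VV_even _ _ _ hm' (by omega)] at h1 h2
        split_ifs at h1 <;> first | omega | (split_ifs at h2 <;> omega)
      · have hk : k = k' := by
          have h1 := h k
          have h2 := h k'
          rw [VV_odd _ _ _ hm, VV_odd _ _ _ hm'] at h1 h2
          split_ifs at h1 <;> first | omega | (split_ifs at h2 <;> omega)
        subst hk
        have h1 := h (k + p / 2)
        have h2 := h (k + p' / 2)
        rw [VV_odd _ _ _ hm, VV_odd _ _ _ hm'] at h1 h2
        split_ifs at h1 <;> first | omega | (split_ifs at h2 <;> omega)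

theorem fA_VV_even (p k n : ℕ) (hp : p % 2 = 0) (h2 : 2 ≤ p) :
    fA (VV p k) n = if n ≤ k then 0 else if n ≤ k + p / 2 then 1 else 0 := by
  rw [fA_apply, VV_even _ _ _ hp h2]
  split_ifs <;> first | omega | decide

theorem fA_VV_odd (p k : ℕ) (hp : p % 2 = 1) : fA (VV p k) = VV 0 (k + 1) := by
  funext n
  rw [fA_apply, VV_odd _ _ _ hp, VV_zero]
  split_ifs <;> first | omega | decide

theorem fA_VV_inj (p k p' k' : ℕ) (hp : p % 2 = 0) (h2 : 2 ≤ p) (hp' : p' % 2 = 0) (h2' : 2 ≤ p')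
    (h : fA (VV p k) = fA (VV p' k')) : p = p' ∧ k = k' := by
  have h := congrFun h
  have hk : k = k' := by
    have h1 := h (k + 1)
    have h2 := h (k' + 1)
    rw [fA_VV_even _ _ _ hp (by omega), fA_VV_even _ _ _ hp' (by omega)] at h1 h2
    split_ifs at h1 <;> first | omega | (split_ifs at h2 <;> omega)
  subst hk
  have h1 := h (k + p / 2)
  have h2 := h (k + p' / 2)
  rw [fA_VV_even _ _ _ hp (by omega), fA_VV_even _ _ _ hp' (by omega)] at h1 h2
  split_ifs at h1 <;> first | omega | (split_ifs at h2 <;> omega)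

theorem VV_ne_fA (p k p' k' : ℕ) (hp' : p' % 2 = 0) (h2' : 2 ≤ p') : VV p k ≠ fA (VV p' k') := by
  intro h
  have h := congrFun h
  by_cases hp : p = 0
  · subst hp
    have h1 := h 0
    have h2 := h (k' + 1)
    rw [VV_zero, fA_VV_even _ _ _ hp' (by omega)] at h1 h2
    split_ifs at h1 <;> first | omega | (split_ifs at h2 <;> omega)
  · rcases Nat.mod_two_eq_zero_or_one p with hm | hm
    · have h1 := h (k + p / 2)
      rw [VV_even _ _ _ hm (by omega), fA_VV_even _ _ _ hp' (by omega)] at h1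
      split_ifs at h1 <;> omega
    · have h1 := h k
      rw [VV_odd _ _ _ hm, fA_VV_even _ _ _ hp' (by omega)] at h1
      split_ifs at h1 <;> omega

def Good (s p : ℕ) : Prop := s = 0 ∨ (s = 1 ∧ p % 2 = 0 ∧ 2 ≤ p)

theorem VS_inj (s p k s' p' k' : ℕ) (hg : Good s p) (hg' : Good s' p')
    (h : fA^[s] (VV p k) = fA^[s'] (VV p' k')) : s = s' ∧ p = p' ∧ k = k' := by
  rcases hg with rfl | ⟨rfl, h1, h2⟩ <;> rcases hg' with rfl | ⟨rfl, h1', h2'⟩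
  · exact ⟨rfl, VV_inj _ _ _ _ h⟩
  · exact absurd h (VV_ne_fA _ _ _ _ h1' h2')
  · exact absurd h.symm (VV_ne_fA _ _ _ _ h1 h2)
  · exact ⟨rfl, fA_VV_inj _ _ _ _ h1 h2 h1' h2' h⟩

theorem one_iter (p : ℕ) : fB^[p] (fun _ => 1) = fun _ => if p % 2 = 0 then 1 else 3 := by
  induction p with
  | zero => rfl
  | succ p ih =>
    rw [Function.iterate_succ_apply', ih]
    rcases Nat.mod_two_eq_zero_or_one p with h | h
    · simp only [h, if_true, show (p + 1) % 2 = 1 by omega, fB_one]; rfl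
    · simp only [h, show (p + 1) % 2 = 0 by omega, if_true]; exact fB_three

theorem VV_far (p k : ℕ) : VV p k (k + p + 1) = 0 := by
  unfold VV
  split_ifs <;> first | omega | rfl

theorem VS_ne_par (s p k : ℕ) (hg : Good s p) :
    fA^[s] (VV p k) ≠ fA^[s] (fB^[p] (fun _ => 1)) := by
  intro h
  rw [one_iter] at h
  rcases hg with rfl | ⟨rfl, h1, h2⟩
  · have := congrFun h (k + p + 1)
    simp only [Function.iterate_zero, id, VV_far] at this
    split_ifs at this <;> exact absurd this (by decide)
  · have := congrFun h (k + 1)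
    simp only [Function.iterate_one, h1, if_true, fA_one, fA_VV_even _ _ _ h1 h2] at this
    split_ifs at this <;> omega

/-! ### signatures -/
def kk (k t : ℕ) : ℕ := if t = 3 then k - 1 else k

theorem InP_t (n s p k t : ℕ) (h : InP n s p k t) : t = 0 ∨ t = 1 ∨ t = 2 ∨ t = 3 := by
  rcases h with h | h <;> omega

theorem InP_t3 (n s p k : ℕ) (h : InP n s p k 3) : 1 ≤ k ∧ (p ≠ 0 ∨ k ≠ 1) := by
  rcases h with h | h <;> omega

theorem InP_good (n s p k t : ℕ) (h : InP n s p k t) :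
    Good s p ∨ (s = 1 ∧ p % 2 = 1 ∧ k = 0 ∧ t = 0 ∧ p + 1 = n ∧ 2 ≤ p) := by
  unfold Good
  rcases h with h | h <;> omega

theorem E0 (n s p k t : ℕ) (h : InP n s p k t) :
    el s p k t (fun _ => 0) = fA^[s] (VV p (kk k t)) := by
  rcases InP_t _ _ _ _ _ h with rfl | rfl | rfl | rfl
  · rw [el_zero_zero _ _ _ _ _ 0 (show tailF 0 (fun _ => 0) = VV 0 0 from VV00.symm), Nat.zero_add]; rfl
  · rw [el_zero_zero _ _ _ _ _ 0 (by rw [VV00]; exact fA_zero), Nat.zero_add]; rfl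
  · rw [el_zero_zero _ _ _ _ _ 0 (by rw [VV00]; exact aa_const _), Nat.zero_add]; rfl
  · obtain ⟨h1, h2⟩ := InP_t3 _ _ _ _ h
    obtain ⟨r, rfl⟩ : ∃ r, k = r + 1 := ⟨k - 1, by omega⟩
    rw [el_three_zero _ _ _ (by omega)]; rfl

theorem E1_zero (s p k : ℕ) : el s p k 0 (fun _ => 1) = fA^[s] (fB^[p] (fun _ => 1)) :=
  el_par _ _ _ _ _ rfl

theorem E1_pos (n s p k t : ℕ) (h : InP n s p k t) (ht : t ≠ 0) :
    el s p k t (fun _ => 1) = fA^[s] (VV p (kk k t)) := by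
  rcases InP_t _ _ _ _ _ h with rfl | rfl | rfl | rfl
  · omega
  · rw [el_zero_zero _ _ _ _ _ 0 (by rw [VV00]; exact fA_one), Nat.zero_add]; rfl
  · rw [el_zero_zero _ _ _ _ _ 0 (by rw [VV00]; exact aa_const _), Nat.zero_add]; rfl
  · obtain ⟨h1, h2⟩ := InP_t3 _ _ _ _ h
    obtain ⟨r, rfl⟩ : ∃ r, k = r + 1 := ⟨k - 1, by omega⟩
    rw [el_k_succ _ _ _ _ _ 0 ?_, Nat.zero_add]
    · rfl
    · show fA (fB (fB _)) = _
      rw [fB_one, fB_three, fA_one, VV00]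

theorem E2_one (s p k : ℕ) : el s p k 1 (fun _ => 2) = fA^[s] (fB^[p] (fun _ => 1)) :=
  el_par _ _ _ _ _ fA_two

theorem E2_pos (s p k t : ℕ) (ht : t = 2 ∨ t = 3) :
    el s p k t (fun _ => 2) = fA^[s] (VV p k) := by
  rcases ht with rfl | rfl
  · rw [el_zero_zero _ _ _ _ _ 0 (by rw [VV00]; exact aa_const _), Nat.zero_add]
  · rw [el_zero_zero _ _ _ _ _ 0 (by rw [VV00]; exact fB_two), Nat.zero_add]

theorem E3_two (s p k : ℕ) : el s p k 2 (fun _ => 3) = fA^[s] (VV p k) := by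
  rw [el_zero_zero _ _ _ _ _ 0 (by rw [VV00]; exact aa_const _), Nat.zero_add]

theorem E3_three (s p k : ℕ) : el s p k 3 (fun _ => 3) = fA^[s] (fB^[p] (fun _ => 1)) :=
  el_par _ _ _ _ _ fB_three

theorem exc_contra (n p s' p' k' t' : ℕ) (hp : p % 2 = 1) (hn : p + 1 = n) (h2 : 2 ≤ p)
    (h' : InP n s' p' k' t') (hg' : Good s' p') (h : el 1 p 0 0 = el s' p' k' t')
    (hx : InP n 1 p 0 0) : False := by
  have e0 := congrFun h (fun _ => 0)
  rw [E0 _ _ _ _ _ h', E0 _ _ _ _ _ hx] at e0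
  have e : fA^[1] (VV p (kk 0 0)) = fA^[0] (VV 0 1) := fA_VV_odd _ _ hp
  rw [e] at e0
  obtain ⟨rfl, rfl, hk⟩ := VS_inj _ _ _ _ _ _ (Or.inl rfl) hg' e0
  by_cases ht : t' = 0
  · subst ht
    have : k' = 1 := hk.symm
    subst this
    simp [InP] at h'
    omega
  · have e1 := congrFun h (fun _ => 1)
    rw [E1_zero, E1_pos _ _ _ _ _ h' ht, one_iter, if_neg (by omega), ← hk] at e1
    have e2 := congrFun e1 1
    rw [Function.iterate_one, fA_three, Function.iterate_zero, id, VV_zero] at e2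
    simp at e2

theorem el_inj (n s p k t s' p' k' t' : ℕ) (hx : InP n s p k t) (hx' : InP n s' p' k' t')
    (h : el s p k t = el s' p' k' t') : s = s' ∧ p = p' ∧ k = k' ∧ t = t' := by
  rcases InP_good _ _ _ _ _ hx with hg | ⟨rfl, h1, rfl, rfl, h4, h5⟩ <;>
    rcases InP_good _ _ _ _ _ hx' with hg' | ⟨rfl, h1', rfl, rfl, h4', h5'⟩
  · have e0 := congrFun h (fun _ => 0)
    rw [E0 _ _ _ _ _ hx, E0 _ _ _ _ _ hx'] at e0
    obtain ⟨rfl, rfl, hk⟩ := VS_inj _ _ _ _ _ _ hg hg' e0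
    have ht : t = t' := by
      have e1 := congrFun h (fun _ => 1)
      have e2 := congrFun h (fun _ => 2)
      have e3 := congrFun h (fun _ => 3)
      by_cases t0 : t = 0 <;> by_cases t0' : t' = 0
      · omega
      · subst t0
        rw [E1_zero, E1_pos _ _ _ _ _ hx' t0'] at e1
        exact absurd e1.symm (VS_ne_par _ _ _ hg)
      · subst t0'
        rw [E1_zero, E1_pos _ _ _ _ _ hx t0] at e1
        exact absurd e1 (VS_ne_par _ _ _ hg)
      · have ht := InP_t _ _ _ _ _ hx
        have ht' := InP_t _ _ _ _ _ hx'
        by_cases t1 : t = 1 <;> by_cases t1' : t' = 1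
        · omega
        · subst t1
          rw [E2_one, E2_pos _ _ _ _ (by omega)] at e2
          exact absurd e2.symm (VS_ne_par _ _ _ hg)
        · subst t1'
          rw [E2_one, E2_pos _ _ _ _ (by omega)] at e2
          exact absurd e2 (VS_ne_par _ _ _ hg)
        · have ht2 : t = 2 ∨ t = 3 := by omega
          have ht2' : t' = 2 ∨ t' = 3 := by omega
          rcases ht2 with rfl | rfl <;> rcases ht2' with rfl | rfl
          · rfl
          · rw [E3_two, E3_three] at e3
            exact absurd e3 (VS_ne_par _ _ _ hg)
          · rw [E3_two, E3_three] at e3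
            exact absurd e3.symm (VS_ne_par _ _ _ hg)
          · rfl
    subst ht
    refine ⟨rfl, rfl, ?_, rfl⟩
    unfold kk at hk
    split_ifs at hk with h3
    · subst h3
      have := InP_t3 _ _ _ _ hx
      have := InP_t3 _ _ _ _ hx'
      omega
    · exact hk
  · exact (exc_contra _ _ _ _ _ _ h1' h4' h5' hx hg h.symm hx').elim
  · exact (exc_contra _ _ _ _ _ _ h1 h4 h5 hx' hg' h hx).elim
  · omega

theorem growth_eq_s6 (n : ℕ) : growth a4Tr a4Out (n + 1) = (PF (n + 1)).card := by
  unfold growth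
  rw [reach_eq, Set.InjOn.ncard_image, Set.ncard_coe_finset]
  rintro ⟨s, p, k, t⟩ hx ⟨s', p', k', t'⟩ hx' h
  rw [Finset.mem_coe, mem_PF] at hx hx'
  obtain ⟨rfl, rfl, rfl, rfl⟩ := el_inj _ _ _ _ _ _ _ _ _ hx hx' h
  rfl

/-- The growth function `γ` of `A₄` satisfies `γ(2) = 4`, `γ(2n) = 4n² − 5n + 6` for every
`n ≥ 2`, and `γ(2n+1) = (7n² + 3n + 4)/2` for every `n ≥ 0` (stated multiplied by `2` to
avoid division); in particular `γ` is a composite non-monotonic function of quadratic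
growth order. -/
theorem growth_a4 :
    growth a4Tr a4Out 2 = 4 ∧
    (∀ n : ℕ, 2 ≤ n → growth a4Tr a4Out (2 * n) = 4 * n ^ 2 - 5 * n + 6) ∧
    (∀ n : ℕ, 2 * growth a4Tr a4Out (2 * n + 1) = 7 * n ^ 2 + 3 * n + 4) := by
  refine ⟨?_, ?_, ?_⟩
  · rw [growth_eq_s6 1]; exact card_PF_two
  · intro n hn
    obtain ⟨m, hm⟩ : ∃ m, 2 * n = m + 1 := ⟨2 * n - 1, by omega⟩
    rw [hm, growth_eq_s6, ← hm, card_PF_even n hn]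
  · intro n
    rw [growth_eq_s6, card_PF_odd]
end

section
/- Let m ≥ 3 and let γ be the growth function of the Mealy automaton B_m. Then γ has growth order [n^(m−1)]: there exist natural numbers C₁, C₂, N₀ ≥ 1 such that for all n ≥ N₀, γ(n) ≤ C₁·(C₂·n)^(m−1) and n^(m−1) ≤ C₁·γ(C₂·n). -/
/-- Output function of the automaton `B_m`: at `q0` the output swaps `x0` and `x1` and fixes
every other letter; at `q1` the output sends `x_i` to `x_{i+1}` for `i ≤ m−2` and fixes
`x_{m−1}`. -/
def bmOut (m : ℕ) : Fin m → Fin 2 → Fin m := fun x q =>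
  if q = 0 then
    if (x : ℕ) = 0 then ⟨1 % m, Nat.mod_lt 1 x.pos⟩
    else if (x : ℕ) = 1 then ⟨0, x.pos⟩
    else x
  else ⟨min (x.val + 1) (m - 1), by have := x.pos; omega⟩

/-- Transition function of the automaton `B_m`: from `q0` the transition goes to `q1` on
reading `x2` and stays at `q0` otherwise; from `q1` it goes to `q0` on reading `x0` and
stays at `q1` otherwise. -/
def bmTr (m : ℕ) : Fin m → Fin 2 → Fin 2 := fun x q =>
  if q = 0 then (if (x : ℕ) = 2 then 1 else 0)
  else (if (x : ℕ) = 0 then 0 else 1)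

/-- The automatic transformations `f0, f1` of the automaton `B_m` at states `q0, q1`. -/
def bmF (m : ℕ) (q : Fin 2) : (ℕ → Fin m) → (ℕ → Fin m) := autTrans (bmTr m) (bmOut m) q

namespace BM

/-- Output of `B_m` on natural-number letters. -/
def oN (m x : ℕ) (q : Fin 2) : ℕ :=
  if q = 0 then (if x = 0 then 1 else if x = 1 then 0 else x) else min (x + 1) (m - 1)

/-- Transition of `B_m` on natural-number letters. -/
def tN (x : ℕ) (q : Fin 2) : Fin 2 :=
  if q = 0 then (if x = 2 then 1 else 0) else (if x = 0 then 0 else 1)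

/-- Final letter after applying the word (head applied first). -/
def fin (m : ℕ) : List (Fin 2) → ℕ → ℕ
  | [], x => x
  | q :: l, x => fin m l (oN m x q)

/-- Section of the word at a letter. -/
def sec (m : ℕ) : List (Fin 2) → ℕ → List (Fin 2)
  | [], _ => []
  | q :: l, x => tN x q :: sec m l (oN m x q)

/-- Action of a word, head applied first. -/
def act (m : ℕ) : List (Fin 2) → (ℕ → Fin m) → (ℕ → Fin m)
  | [], u => u
  | q :: l, u => act m l (autTrans (bmTr m) (bmOut m) q u)

lemma oN_lt {m x : ℕ} (hm : 3 ≤ m) (hx : x < m) (q : Fin 2) : oN m x q < m := by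
  unfold oN; split_ifs <;> omega

lemma val_out {m : ℕ} (hm : 3 ≤ m) (x : Fin m) (q : Fin 2) :
    (bmOut m x q : ℕ) = oN m x q := by
  have : 1 % m = 1 := Nat.mod_eq_of_lt (by omega)
  unfold bmOut oN; split_ifs <;> simp_all

lemma tr_eq {m : ℕ} (x : Fin m) (q : Fin 2) : bmTr m x q = tN x q := by
  unfold bmTr tN; rfl

lemma stateSeq_succ {X Q : Type*} (tr : X → Q → Q) (q : Q) (u : ℕ → X) (n : ℕ) :
    stateSeq tr q u (n + 1) = stateSeq tr (tr (u 0) q) (fun k => u (k + 1)) n := by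
  induction n with
  | zero => rfl
  | succ n ih => rw [stateSeq, ih]; rfl

lemma act_zero {m : ℕ} (hm : 3 ≤ m) (l : List (Fin 2)) (u : ℕ → Fin m) :
    (act m l u 0 : ℕ) = fin m l (u 0) := by
  induction l generalizing u with
  | nil => rfl
  | cons q l ih =>
    rw [act, ih, fin]
    congr 1
    exact val_out hm (u 0) q

lemma act_succ {m : ℕ} (hm : 3 ≤ m) (l : List (Fin 2)) (u : ℕ → Fin m) (n : ℕ) :
    act m l u (n + 1) = act m (sec m l (u 0)) (fun k => u (k + 1)) n := by
  induction l generalizing u with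
  | nil => rfl
  | cons q l ih =>
    rw [act, ih, sec, act]
    have h1 : ((autTrans (bmTr m) (bmOut m) q u 0 : Fin m) : ℕ) = oN m (u 0) q := val_out hm (u 0) q
    rw [h1]
    have h2 : (fun k => autTrans (bmTr m) (bmOut m) q u (k + 1)) =
        autTrans (bmTr m) (bmOut m) (tN (u 0) q) (fun k => u (k + 1)) := by
      funext k
      unfold autTrans
      rw [stateSeq_succ, tr_eq]
    rw [h2]

lemma act_inj {m : ℕ} (hm : 3 ≤ m) {v w : List (Fin 2)} (h : act m v = act m w)
    {x : ℕ} (hx : x < m) :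
    fin m v x = fin m w x ∧ act m (sec m v x) = act m (sec m w x) := by
  constructor
  · have := congrFun (congrFun h (fun _ => ⟨x, hx⟩)) 0
    have h2 := congrArg Fin.val this
    rwa [act_zero hm, act_zero hm] at h2
  · funext u n
    have := congrFun (congrFun h (fun k => Nat.casesOn k ⟨x, hx⟩ u)) (n + 1)
    rw [act_succ hm, act_succ hm] at this
    exact this

/-- Agreement of two words up to depth `d`. -/
def Eqv (m : ℕ) : ℕ → List (Fin 2) → List (Fin 2) → Prop
  | 0, _, _ => True
  | d + 1, v, w => ∀ x < m, fin m v x = fin m w x ∧ Eqv m d (sec m v x) (sec m w x)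

lemma Eqv.refl {m : ℕ} (d : ℕ) (v : List (Fin 2)) : Eqv m d v v := by
  induction d generalizing v with
  | zero => trivial
  | succ d ih => exact fun x _ => ⟨rfl, ih _⟩

lemma Eqv.symm {m d : ℕ} {v w : List (Fin 2)} (h : Eqv m d v w) : Eqv m d w v := by
  induction d generalizing v w with
  | zero => trivial
  | succ d ih => exact fun x hx => ⟨(h x hx).1.symm, ih (h x hx).2⟩

lemma Eqv.trans {m d : ℕ} {v w z : List (Fin 2)} (h : Eqv m d v w) (h' : Eqv m d w z) :
    Eqv m d v z := by
  induction d generalizing v w z with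
  | zero => trivial
  | succ d ih =>
    exact fun x hx => ⟨(h x hx).1.trans (h' x hx).1, ih (h x hx).2 (h' x hx).2⟩

lemma fin_append (m : ℕ) (v w : List (Fin 2)) (x : ℕ) :
    fin m (v ++ w) x = fin m w (fin m v x) := by
  induction v generalizing x with
  | nil => rfl
  | cons q v ih => exact ih _

lemma sec_append (m : ℕ) (v w : List (Fin 2)) (x : ℕ) :
    sec m (v ++ w) x = sec m v x ++ sec m w (fin m v x) := by
  induction v generalizing x with
  | nil => rfl
  | cons q v ih => simp only [List.cons_append, sec, fin, ih]

lemma fin_lt {m x : ℕ} (hm : 3 ≤ m) (hx : x < m) (l : List (Fin 2)) : fin m l x < m := by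
  induction l generalizing x with
  | nil => exact hx
  | cons q l ih => exact ih (oN_lt hm hx q)

lemma Eqv.suf {m d : ℕ} {v w : List (Fin 2)} (h : Eqv m d v w) (s : List (Fin 2)) :
    Eqv m d (v ++ s) (w ++ s) := by
  induction d generalizing v w s with
  | zero => trivial
  | succ d ih =>
    intro x hx
    rw [fin_append, fin_append, sec_append, sec_append, (h x hx).1]
    exact ⟨rfl, ih (h x hx).2 _⟩

lemma Eqv.pre {m d : ℕ} (hm : 3 ≤ m) {v w : List (Fin 2)} (h : Eqv m d v w)
    (p : List (Fin 2)) : Eqv m d (p ++ v) (p ++ w) := by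
  induction d generalizing v w p with
  | zero => trivial
  | succ d ih =>
    intro x hx
    rw [fin_append, fin_append, sec_append, sec_append]
    have := h _ (fin_lt hm hx p)
    exact ⟨this.1, ih this.2 _⟩

lemma act_eq_of {m : ℕ} (hm : 3 ≤ m) {v w : List (Fin 2)} (h : ∀ d, Eqv m d v w) :
    act m v = act m w := by
  funext u k
  have h' := h (k + 1)
  clear h
  induction k generalizing v w u with
  | zero =>
    apply Fin.ext
    rw [act_zero hm, act_zero hm]
    exact (h' _ (u 0).2).1
  | succ k ih =>
    rw [act_succ hm, act_succ hm]
    exact ih _ (h' _ (u 0).2).2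

/-- Fill with ones up to the first one. -/
def fill : List (Fin 2) → List (Fin 2)
  | [] => []
  | q :: l => if q = 0 then 1 :: fill l else 1 :: l

/-- The section at the letter 2. -/
def fillm (m : ℕ) (l : List (Fin 2)) : List (Fin 2) :=
  if m = 3 then List.replicate l.length 1 else fill l

/-- number of ones -/
abbrev cnt (l : List (Fin 2)) : ℕ := l.count 1

lemma fin_ge {m x : ℕ} (hx : 2 ≤ x) (hxm : x < m) (l : List (Fin 2)) :
    fin m l x = min (x + cnt l) (m - 1) := by
  induction l generalizing x with
  | nil => simp [fin]; omega
  | cons q l ih =>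
    rw [fin]
    rcases Fin.exists_fin_two.1 ⟨q, rfl⟩ with rfl | rfl
    · have : oN m x 0 = x := by unfold oN; rw [if_pos rfl, if_neg (by omega), if_neg (by omega)]
      rw [this, ih hx hxm]; simp
    · have : oN m x 1 = min (x + 1) (m - 1) := by simp [oN]
      rw [this, ih (by omega) (by omega)]; simp only [cnt, List.count_cons_self]; omega

lemma sec_ge {m x : ℕ} (hx : 3 ≤ x) (hxm : x < m) (l : List (Fin 2)) :
    sec m l x = l := by
  induction l generalizing x with
  | nil => rfl
  | cons q l ih =>
    rw [sec]
    rcases Fin.exists_fin_two.1 ⟨q, rfl⟩ with rfl | rfl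
    · have : oN m x 0 = x := by unfold oN; rw [if_pos rfl, if_neg (by omega), if_neg (by omega)]
      rw [this, ih hx hxm]; simp [tN]; omega
    · have : oN m x 1 = min (x + 1) (m - 1) := by simp [oN]
      rw [this, ih (by omega) (by omega)]; simp [tN]; omega

lemma sec_two {m : ℕ} (hm : 3 ≤ m) (l : List (Fin 2)) : sec m l 2 = fillm m l := by
  unfold fillm
  induction l with
  | nil => split_ifs <;> rfl
  | cons q l ih =>
    rw [sec]
    rcases Fin.exists_fin_two.1 ⟨q, rfl⟩ with rfl | rfl
    · have : oN m 2 0 = 2 := by simp [oN]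
      rw [this, ih]; split_ifs <;> simp [tN, fill, List.replicate_succ]
    · by_cases h : m = 3
      · have : oN m 2 1 = 2 := by simp [oN, h]
        rw [this, ih]; simp [tN, h, List.replicate_succ]
      · have : oN m 2 1 = 3 := by simp [oN]; omega
        rw [this, sec_ge le_rfl (by omega)]; simp [tN, h, fill]

lemma fin_zeros {m x : ℕ} (hx : x < 2) (a : ℕ) :
    fin m (List.replicate a 0) x = (x + a) % 2 := by
  induction a generalizing x with
  | zero => simp [fin]; omega
  | succ a ih =>
    rw [List.replicate_succ, fin]
    have : oN m x 0 = 1 - x := by simp [oN]; split_ifs <;> omega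
    rw [this, ih (by omega)]; omega

lemma sec_zeros {m x : ℕ} (hx : x < 2) (a : ℕ) :
    sec m (List.replicate a 0) x = List.replicate a 0 := by
  induction a generalizing x with
  | zero => rfl
  | succ a ih =>
    rw [List.replicate_succ, sec]
    have : oN m x 0 = 1 - x := by simp [oN]; split_ifs <;> omega
    rw [this, ih (by omega)]; simp [tN]; omega

lemma fillm_cons_zero (m : ℕ) (l : List (Fin 2)) : fillm m (0 :: l) = 1 :: fillm m l := by
  unfold fillm; split_ifs <;> simp [fill, List.replicate_succ]

lemma fillm_cons_one {m : ℕ} (h : m ≠ 3) (l : List (Fin 2)) : fillm m (1 :: l) = 1 :: l := by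
  unfold fillm; simp [h, fill]

lemma fillm_three {m : ℕ} (h : m = 3) (l : List (Fin 2)) :
    fillm m l = List.replicate l.length 1 := by
  unfold fillm; simp [h]

lemma fillm_zeros (m a : ℕ) (l : List (Fin 2)) :
    fillm m (List.replicate a 0 ++ l) = List.replicate a 1 ++ fillm m l := by
  induction a with
  | zero => simp
  | succ a ih => simp only [List.replicate_succ, List.cons_append, fillm_cons_zero, ih]

lemma fin_one_zero {m : ℕ} (hm : 3 ≤ m) (l : List (Fin 2)) : fin m (1 :: l) 0 = fin m l 1 := by
  have : oN m 0 1 = 1 := by simp [oN]; omega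
  rw [fin, this]

lemma sec_one_zero {m : ℕ} (hm : 3 ≤ m) (l : List (Fin 2)) :
    sec m (1 :: l) 0 = 0 :: sec m l 1 := by
  have : oN m 0 1 = 1 := by simp [oN]; omega
  rw [sec, this]; simp [tN]

lemma fin_one_one {m : ℕ} (hm : 3 ≤ m) (l : List (Fin 2)) :
    fin m (1 :: l) 1 = min (2 + cnt l) (m - 1) := by
  have : oN m 1 1 = 2 := by simp [oN]; omega
  rw [fin, this, fin_ge le_rfl (by omega)]

lemma sec_one_one {m : ℕ} (hm : 3 ≤ m) (l : List (Fin 2)) :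
    sec m (1 :: l) 1 = 1 :: fillm m l := by
  have : oN m 1 1 = 2 := by simp [oN]; omega
  rw [sec, this, sec_two hm]; simp [tN]

/-- Rule two. -/
def R2 (m d : ℕ) : Prop := ∀ (p q : ℕ) (V : List (Fin 2)), m - 3 ≤ cnt V →
  Eqv m d (1 :: (List.replicate (2 * p) 0 ++ 1 :: (List.replicate (2 * q) 0 ++ 1 :: V)))
    (1 :: (List.replicate (2 * p) 0 ++ 1 :: (List.replicate (2 * q) 0 ++ 0 :: V)))

/-- Rule one. -/
def R1 (m d : ℕ) : Prop := ∀ (p : ℕ) (V : List (Fin 2)), m - 3 ≤ cnt V →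
  Eqv m d (1 :: (List.replicate (2 * p + 1) 0 ++ 1 :: V))
    (1 :: (List.replicate (2 * p + 1) 0 ++ 0 :: V))

lemma fill_eqv {m d : ℕ} (hm : 3 ≤ m) (h : R2 m d) (V : List (Fin 2)) (hV : m - 3 ≤ cnt V) :
    Eqv m d (1 :: 1 :: V) (1 :: 1 :: fill V) := by
  induction V with
  | nil => exact Eqv.refl _ _
  | cons q l ih =>
    rcases Fin.exists_fin_two.1 ⟨q, rfl⟩ with rfl | rfl
    · have hl : m - 3 ≤ cnt l := by simpa using hV
      have h1 := (h 0 0 l hl).symm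
      simp only [Nat.mul_zero, List.replicate_zero, List.nil_append] at h1
      have h2 := (ih hl).pre hm [1]
      have := h1.trans h2
      simpa [fill] using this
    · simp only [fill]; exact Eqv.refl _ _

lemma fillm_eqv {m d : ℕ} (hm : 3 ≤ m) (h : R2 m d) (c : ℕ) (V : List (Fin 2))
    (hV : m - 3 ≤ cnt V) :
    Eqv m d (1 :: fillm m (List.replicate c 0 ++ 1 :: V))
      (1 :: fillm m (List.replicate c 0 ++ 0 :: V)) := by
  by_cases h3 : m = 3
  · rw [fillm_three h3, fillm_three h3]
    simp only [List.length_append, List.length_cons]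
    exact Eqv.refl _ _
  · rw [fillm_zeros, fillm_zeros, fillm_cons_zero, fillm_cons_one h3]
    have := (fill_eqv hm h V hV).pre hm (List.replicate c 1)
    have e : ∀ X : List (Fin 2), 1 :: (List.replicate c 1 ++ 1 :: X) =
        List.replicate c 1 ++ 1 :: 1 :: X := by
      intro X
      rw [← List.cons_append, ← List.replicate_succ, List.replicate_succ']; simp
    rw [e, e]
    unfold fillm; rw [if_neg h3]; exact this

lemma fillm_eqv_of {m d : ℕ} (a : ℕ) {v w : List (Fin 2)} (hm : 3 ≤ m)
    (hl : v.length = w.length) (h : Eqv m d (1 :: v) (1 :: w)) :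
    Eqv m d (fillm m (List.replicate a 0 ++ 1 :: v)) (fillm m (List.replicate a 0 ++ 1 :: w)) := by
  by_cases h3 : m = 3
  · rw [fillm_three h3, fillm_three h3]
    simp only [List.length_append, List.length_cons, hl]
    exact Eqv.refl _ _
  · rw [fillm_zeros, fillm_zeros, fillm_cons_one h3, fillm_cons_one h3]
    exact h.pre hm _

lemma cnt_zeros (a : ℕ) (l : List (Fin 2)) : cnt (List.replicate a 0 ++ l) = cnt l := by
  simp [cnt, List.count_append, List.count_replicate]

lemma cnt_zero (l : List (Fin 2)) : cnt (0 :: l) = cnt l := by simp [cnt]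
lemma cnt_one (l : List (Fin 2)) : cnt (1 :: l) = cnt l + 1 := by simp [cnt]

lemma r2 {m : ℕ} (hm : 3 ≤ m) (d : ℕ) : R2 m d := by
  induction d with
  | zero => intro p q V _; trivial
  | succ d ih =>
    intro p q V hV x hx
    have key := ih p q V hV
    rcases (by omega : x = 0 ∨ x = 1 ∨ x = 2 ∨ 3 ≤ x) with rfl | rfl | rfl | h3
    · rw [fin_one_zero hm, fin_one_zero hm, sec_one_zero hm, sec_one_zero hm,
        fin_append, fin_append, sec_append, sec_append, fin_zeros (by omega),
        (by omega : (1 + 2 * p) % 2 = 1), fin_one_one hm, fin_one_one hm, sec_one_one hm,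
        sec_one_one hm]
      simp only [cnt_zeros, cnt_zero, cnt_one]
      refine ⟨by omega, ?_⟩
      have := (fillm_eqv hm ih (2 * q) V hV).pre hm (0 :: sec m (List.replicate (2 * p) 0) 1)
      exact this
    · rw [fin_one_one hm, fin_one_one hm, sec_one_one hm, sec_one_one hm]
      simp only [cnt_zeros, cnt_zero, cnt_one]
      refine ⟨by omega, ?_⟩
      by_cases hm3 : m = 3
      · rw [fillm_three hm3, fillm_three hm3]
        simp only [List.length_append, List.length_cons]
        exact Eqv.refl _ _
      · rw [fillm_zeros, fillm_zeros, fillm_cons_one hm3, fillm_cons_one hm3]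
        have e : ∀ X : List (Fin 2), 1 :: (List.replicate (2 * p) 1 ++ 1 :: X) =
            List.replicate (2 * p) 1 ++ 1 :: 1 :: X := by
          intro X
          rw [← List.cons_append, ← List.replicate_succ, List.replicate_succ']; simp
        rw [e, e]
        exact (ih 0 q V hV).pre hm _
    · rw [fin_ge le_rfl hx, fin_ge le_rfl hx, sec_two hm, sec_two hm]
      simp only [cnt_zeros, cnt_zero, cnt_one]
      exact ⟨by omega, fillm_eqv_of 0 hm (by simp) key⟩
    · rw [fin_ge (by omega) hx, fin_ge (by omega) hx, sec_ge h3 hx, sec_ge h3 hx]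
      simp only [cnt_zeros, cnt_zero, cnt_one]
      exact ⟨by omega, key⟩

lemma r1 {m : ℕ} (hm : 3 ≤ m) (d : ℕ) : R1 m d := by
  induction d with
  | zero => intro p V _; trivial
  | succ d ih =>
    intro p V hV x hx
    have key := ih p V hV
    rcases (by omega : x = 0 ∨ x = 1 ∨ x = 2 ∨ 3 ≤ x) with rfl | rfl | rfl | h3
    · rw [fin_one_zero hm, fin_one_zero hm, sec_one_zero hm, sec_one_zero hm,
        fin_append, fin_append, sec_append, sec_append, fin_zeros (by omega),
        (by omega : (1 + (2 * p + 1)) % 2 = 0), fin_one_zero hm, sec_one_zero hm]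
      have h0 : oN m 0 0 = 1 := by simp [oN]
      have h1 : tN 0 0 = 0 := by simp [tN]
      rw [fin, sec, h0, h1]
      exact ⟨rfl, Eqv.refl _ _⟩
    · rw [fin_one_one hm, fin_one_one hm, sec_one_one hm, sec_one_one hm]
      simp only [cnt_zeros, cnt_zero, cnt_one]
      exact ⟨by omega, fillm_eqv hm (r2 hm d) _ V hV⟩
    · rw [fin_ge le_rfl hx, fin_ge le_rfl hx, sec_two hm, sec_two hm]
      simp only [cnt_zeros, cnt_zero, cnt_one]
      exact ⟨by omega, fillm_eqv_of 0 hm (by simp) key⟩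
    · rw [fin_ge (by omega) hx, fin_ge (by omega) hx, sec_ge h3 hx, sec_ge h3 hx]
      simp only [cnt_zeros, cnt_zero, cnt_one]
      exact ⟨by omega, key⟩

lemma split_one (l : List (Fin 2)) (h : 1 ≤ cnt l) :
    ∃ a V, l = List.replicate a 0 ++ 1 :: V ∧ cnt l = cnt V + 1 := by
  induction l with
  | nil => simp [cnt] at h
  | cons q l ih =>
    rcases Fin.exists_fin_two.1 ⟨q, rfl⟩ with rfl | rfl
    · rw [cnt_zero] at h
      obtain ⟨a, V, rfl, h2⟩ := ih h
      exact ⟨a + 1, V, by simp [List.replicate_succ], by rw [cnt_zero, h2]⟩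
    · exact ⟨0, l, by simp, cnt_one l⟩

lemma reduce {m : ℕ} (hm : 3 ≤ m) (l : List (Fin 2)) (h : m ≤ cnt l) :
    ∃ l' : List (Fin 2), l'.length = l.length ∧ cnt l' + 1 = cnt l ∧ act m l = act m l' := by
  obtain ⟨a, V1, rfl, h1⟩ := split_one l (by omega)
  obtain ⟨b, V2, rfl, h2⟩ := split_one V1 (by omega)
  obtain ⟨c, V, rfl, h3⟩ := split_one V2 (by omega)
  simp only [cnt_zeros, cnt_one] at h1 h2 h3 h
  rcases Nat.even_or_odd' b with ⟨p, rfl | rfl⟩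
  · rcases Nat.even_or_odd' c with ⟨q, rfl | rfl⟩
    · refine ⟨_, ?_, ?_, act_eq_of hm fun d => (r2 hm d p q V (by omega)).pre hm _⟩
      · simp
      · simp only [cnt_zeros, cnt_one, cnt_zero]
    · refine ⟨List.replicate a 0 ++ 1 :: (List.replicate (2 * p) 0 ++ 1 :: (List.replicate (2 * q + 1) 0 ++ 0 :: V)), ?_, ?_, act_eq_of hm fun d => ?_⟩
      · simp
      · simp only [cnt_zeros, cnt_one, cnt_zero]
      · have := (r1 hm d q V (by omega)).pre hm
          (List.replicate a 0 ++ 1 :: List.replicate (2 * p) 0)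
        simpa using this
  · refine ⟨_, ?_, ?_, act_eq_of hm fun d =>
      (r1 hm d p (List.replicate c 0 ++ 1 :: V) (by simp only [cnt_zeros, cnt_one]; omega)).pre
        hm _⟩
    · simp
    · simp only [cnt_zeros, cnt_one, cnt_zero]

lemma reduce_all {m : ℕ} (hm : 3 ≤ m) (k : ℕ) (l : List (Fin 2)) (hk : cnt l ≤ k) :
    ∃ l' : List (Fin 2), l'.length = l.length ∧ cnt l' ≤ m - 1 ∧ act m l = act m l' := by
  induction k generalizing l with
  | zero => exact ⟨l, rfl, by omega, rfl⟩
  | succ k ih =>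
    by_cases h : m ≤ cnt l
    · obtain ⟨l1, h1, h2, h3⟩ := reduce hm l h
      obtain ⟨l2, h4, h5, h6⟩ := ih l1 (by omega)
      exact ⟨l2, h4.trans h1, h5, h3.trans h6⟩
    · exact ⟨l, rfl, by omega, rfl⟩

/-- Word coded by a list of gaps. -/
def code : List ℕ → List (Fin 2)
  | [] => []
  | a :: t => List.replicate a 0 ++ 1 :: code t

lemma exists_code (N k : ℕ) (l : List (Fin 2)) (h : cnt l ≤ k) (hN : l.length ≤ N) :
    ∃ t : List ℕ, t.length = k ∧ (∀ a ∈ t, a ≤ N) ∧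
      l = (code t ++ List.replicate N 0).take l.length := by
  induction k generalizing l with
  | zero =>
    refine ⟨[], rfl, by simp, ?_⟩
    simp only [code, List.nil_append, List.take_replicate, Nat.min_eq_left hN]
    refine List.eq_replicate_iff.2 ⟨rfl, fun b hb => ?_⟩
    rcases Fin.exists_fin_two.1 ⟨b, rfl⟩ with h' | h'
    · exact h'
    · subst h'
      have := List.count_pos_iff.2 hb
      simp only [cnt] at h; omega
  | succ k ih =>
    by_cases h0 : 1 ≤ cnt l
    · obtain ⟨a, V, rfl, h1⟩ := split_one l h0
      simp only [List.length_append, List.length_replicate, List.length_cons] at hN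
      obtain ⟨t, ht1, ht2, ht3⟩ := ih V (by omega) (by omega)
      refine ⟨a :: t, by simp [ht1], ?_, ?_⟩
      · intro b hb
        rcases List.mem_cons.1 hb with rfl | hb
        · omega
        · exact ht2 b hb
      · simp only [code, List.append_assoc, List.length_append, List.length_replicate,
          List.length_cons, List.cons_append]
        have e := List.take_length_add_append (l₁ := List.replicate a (0 : Fin 2))
          (l₂ := 1 :: (code t ++ List.replicate N 0)) (V.length + 1)
        rw [List.length_replicate] at e
        rw [e, List.take_succ_cons, ← ht3]
    · have hz : l = List.replicate l.length 0 := by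
        refine List.eq_replicate_iff.2 ⟨rfl, fun b hb => ?_⟩
        rcases Fin.exists_fin_two.1 ⟨b, rfl⟩ with h' | h'
        · exact h'
        · subst h'
          have := List.count_pos_iff.2 hb
          simp only [cnt] at h0; omega
      refine ⟨List.replicate (k + 1) N, by simp, ?_, ?_⟩
      · intro a ha; exact (List.eq_of_mem_replicate ha).le
      · rw [List.replicate_succ, code, List.append_assoc, List.take_append_of_le_length (by simpa),
          List.take_replicate, Nat.min_eq_left hN]
        exact hz

lemma wordTrans_eq (m : ℕ) (w : List (Fin 2)) :
    wordTrans (bmTr m) (bmOut m) w = act m w.reverse := by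
  have happ : ∀ (v w : List (Fin 2)) u, act m (v ++ w) u = act m w (act m v u) := by
    intro v w
    induction v with
    | nil => intro u; rfl
    | cons q v ih => intro u; exact ih _
  funext u
  induction w with
  | nil => rfl
  | cons q w ih =>
    rw [List.reverse_cons, happ, ← ih]
    rfl

lemma growth_eq (m n : ℕ) : growth (bmTr m) (bmOut m) n =
    Set.ncard (Set.image (act m) {w | w.length = n}) := by
  unfold growth
  congr 1
  ext g
  constructor
  · rintro ⟨w, hw, rfl⟩
    exact ⟨w.reverse, by simpa using hw, (wordTrans_eq m w).symm⟩
  · rintro ⟨w, hw, rfl⟩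
    exact ⟨w.reverse, by simpa using hw, by rw [wordTrans_eq, List.reverse_reverse]⟩

lemma upper {m : ℕ} (hm : 3 ≤ m) (n : ℕ) :
    growth (bmTr m) (bmOut m) n ≤ (n + 1) ^ (m - 1) := by
  rw [growth_eq]
  let Φ : (Fin (m - 1) → Fin (n + 1)) → ((ℕ → Fin m) → (ℕ → Fin m)) := fun p =>
    act m ((code (List.ofFn fun i => (p i : ℕ)) ++ List.replicate n 0).take n)
  have hsub : Set.image (act m) {w | w.length = n} ⊆ Set.range Φ := by
    rintro _ ⟨w, hw, rfl⟩
    obtain ⟨l, h1, h2, h3⟩ := reduce_all hm _ w le_rfl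
    rw [Set.mem_ofPred_eq] at hw
    obtain ⟨t, t1, t2, t3⟩ := exists_code n (m - 1) l h2 (by omega)
    refine ⟨fun i => ⟨t.get (i.cast t1.symm), Nat.lt_succ_of_le (t2 _ (List.get_mem _ _))⟩, ?_⟩
    have : (List.ofFn fun i : Fin (m - 1) => t.get (i.cast t1.symm)) = t := by
      apply List.ext_get <;> simp [t1]
    simp only [Φ]
    rw [this, h3]
    rw [h1, hw] at t3
    rw [← t3]
  calc _ ≤ (Set.range Φ).ncard := Set.ncard_le_ncard hsub (Set.finite_range Φ)
    _ ≤ Nat.card (Fin (m - 1) → Fin (n + 1)) := by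
      rw [← Set.image_univ, ← Set.ncard_univ]
      exact Set.ncard_image_le Set.finite_univ
    _ = _ := by simp

lemma fillm_length (m : ℕ) (l : List (Fin 2)) : (fillm m l).length = l.length := by
  unfold fillm
  split_ifs
  · simp
  · induction l with
    | nil => rfl
    | cons q l ih => unfold fill; split_ifs <;> simp [ih]

lemma fillm_cons (m : ℕ) (q : Fin 2) (l : List (Fin 2)) :
    ∃ x, fillm m (q :: l) = 1 :: x ∧ fillm m x = fillm m l := by
  by_cases h3 : m = 3
  · refine ⟨fillm m l, ?_, ?_⟩
    · rw [fillm_three h3, fillm_three h3]; rfl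
    · rw [fillm_three h3, fillm_length, fillm_three h3]
  · rcases Fin.exists_fin_two.1 ⟨q, rfl⟩ with rfl | rfl
    · refine ⟨fillm m l, fillm_cons_zero m l, ?_⟩
      cases l with
      | nil => simp [fillm, fill]
      | cons a l =>
        rcases Fin.exists_fin_two.1 ⟨a, rfl⟩ with rfl | rfl
        · rw [fillm_cons_zero, fillm_cons_one h3]
        · rw [fillm_cons_one h3, fillm_cons_one h3]
    · exact ⟨l, fillm_cons_one h3 l, rfl⟩

/-- The driven word. -/
def drv (m s : ℕ) (r : List (Fin 2)) : List (Fin 2) := List.replicate s 0 ++ 1 :: fillm m r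

lemma drv_step_fin {m : ℕ} (hm : 3 ≤ m) (s : ℕ) (r : List (Fin 2)) :
    fin m (drv m s r) (s % 2) = min (1 + cnt (fillm m r)) (m - 1) := by
  unfold drv
  rw [fin_append, fin_zeros (by omega), (by omega : (s % 2 + s) % 2 = 0), fin_one_zero hm]
  cases r with
  | nil => simp [fillm, fill, fin]; omega
  | cons q l =>
    obtain ⟨x, hx, -⟩ := fillm_cons m q l
    rw [hx, fin_one_one hm, cnt_one]; omega

lemma drv_step_sec {m : ℕ} (hm : 3 ≤ m) (s : ℕ) (q : Fin 2) (r : List (Fin 2)) :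
    sec m (drv m s (q :: r)) (s % 2) = drv m (s + 1) r := by
  unfold drv
  rw [sec_append, sec_zeros (by omega), fin_zeros (by omega), (by omega : (s % 2 + s) % 2 = 0),
    sec_one_zero hm]
  obtain ⟨x, hx, hx2⟩ := fillm_cons m q r
  rw [hx, sec_one_one hm, hx2, List.replicate_succ']; simp

/-- every one is followed by a zero -/
def Good : List (Fin 2) → Prop
  | [] => True
  | q :: l => (q = 1 → ∃ l', l = 0 :: l') ∧ Good l

lemma cnt_le_fill (l : List (Fin 2)) : cnt l ≤ cnt (fill l) := by
  induction l with
  | nil => simp [fill]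
  | cons q l ih =>
    rcases Fin.exists_fin_two.1 ⟨q, rfl⟩ with rfl | rfl
    · simp only [fill, if_true, cnt_zero, cnt_one]; omega
    · simp [fill]

lemma no_mix {m : ℕ} (h3 : m ≠ 3) (hm : 3 ≤ m) (l : List (Fin 2)) (hg : Good (1 :: l))
    (hc : cnt (1 :: l) ≤ m - 3)
    (h : min (1 + cnt (fillm m (1 :: l))) (m - 1) = min (1 + cnt (fillm m (0 :: l))) (m - 1)) :
    False := by
  obtain ⟨l', rfl⟩ := hg.1 rfl
  rw [fillm_cons_one h3, fillm_cons_zero, fillm_cons_zero] at h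
  simp only [cnt_one, cnt_zero] at h hc
  have := cnt_le_fill l'
  unfold fillm at h
  rw [if_neg h3] at h
  omega

lemma drv_len {m : ℕ} (hm : 3 ≤ m) (r r' : List (Fin 2)) (s s' : ℕ) (hs : s % 2 = s' % 2)
    (h : act m (drv m s r) = act m (drv m s' r')) :
    r.length = r'.length ∧ (m ≠ 3 → Good r → Good r' → cnt r ≤ m - 3 → cnt r' ≤ m - 3 → r = r') := by
  induction r generalizing r' s s' with
  | nil =>
    have h1 := (act_inj hm h (x := s % 2) (by omega)).1
    rw [drv_step_fin hm, hs, drv_step_fin hm] at h1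
    cases r' with
    | nil => simp
    | cons b y =>
      obtain ⟨x, hx, -⟩ := fillm_cons m b y
      have e : fillm m [] = [] := List.eq_nil_of_length_eq_zero (by rw [fillm_length]; rfl)
      rw [hx, e, cnt_one] at h1
      simp at h1; omega
  | cons a x ih =>
    have h1 := (act_inj hm h (x := s % 2) (by omega)).1
    have h2 := (act_inj hm h (x := s % 2) (by omega)).2
    rw [drv_step_fin hm, hs, drv_step_fin hm] at h1
    cases r' with
    | nil =>
      obtain ⟨x, hx, -⟩ := fillm_cons m a x
      have e : fillm m [] = [] := List.eq_nil_of_length_eq_zero (by rw [fillm_length]; rfl)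
      rw [hx, e, cnt_one] at h1
      simp at h1; omega
    | cons b y =>
      rw [drv_step_sec hm, hs, drv_step_sec hm] at h2
      obtain ⟨i1, i2⟩ := ih y (s + 1) (s' + 1) (by omega) h2
      refine ⟨by simp [i1], fun h3 g g' c c' => ?_⟩
      have hx : cnt x ≤ cnt (a :: x) := List.count_le_count_cons
      have hy : cnt y ≤ cnt (b :: y) := List.count_le_count_cons
      have := i2 h3 g.2 g'.2 (by omega) (by omega)
      subst this
      rcases Fin.exists_fin_two.1 ⟨a, rfl⟩ with rfl | rfl <;>
      rcases Fin.exists_fin_two.1 ⟨b, rfl⟩ with rfl | rfl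
      · rfl
      · exact (no_mix h3 hm _ g' c' h1.symm).elim
      · exact (no_mix h3 hm _ g c h1).elim
      · rfl

/-- The family of words used for the lower bound. -/
def fam (a c : ℕ) (R : List (Fin 2)) : List (Fin 2) :=
  List.replicate (2 * a) 0 ++ 1 :: (List.replicate (2 * c) 0 ++ 1 :: R)

lemma fam_sec_zero {m : ℕ} (hm : 3 ≤ m) (a c : ℕ) (R : List (Fin 2)) :
    sec m (fam a c R) 0 = drv m (2 * a + 1 + 2 * c) R := by
  unfold fam drv
  rw [sec_append, sec_zeros (by omega), fin_zeros (by omega), (by omega : (0 + 2 * a) % 2 = 0),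
    sec_one_zero hm, sec_append, sec_zeros (by omega), fin_zeros (by omega),
    (by omega : (1 + 2 * c) % 2 = 1), sec_one_one hm]
  simp [List.replicate_add]

lemma fam_sec_one {m : ℕ} (hm : 3 ≤ m) (a c : ℕ) (R : List (Fin 2)) :
    sec m (fam a c R) 1 = drv m (2 * a) (List.replicate (2 * c) 0 ++ 1 :: R) := by
  unfold fam drv
  rw [sec_append, sec_zeros (by omega), fin_zeros (by omega), (by omega : (1 + 2 * a) % 2 = 1),
    sec_one_one hm]

lemma fam_inj {m : ℕ} (hm : 3 ≤ m) {a c a' c' : ℕ} {R R' : List (Fin 2)}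
    (hlen : (fam a c R).length = (fam a' c' R').length)
    (g : Good R) (g' : Good R') (k : cnt R ≤ m - 3) (k' : cnt R' ≤ m - 3)
    (h : act m (fam a c R) = act m (fam a' c' R')) : a = a' ∧ c = c' ∧ (m ≠ 3 → R = R') := by
  have h0 := (act_inj hm h (x := 0) (by omega)).2
  have h1 := (act_inj hm h (x := 1) (by omega)).2
  rw [fam_sec_zero hm, fam_sec_zero hm] at h0
  rw [fam_sec_one hm, fam_sec_one hm] at h1
  obtain ⟨l0, e0⟩ := drv_len hm _ _ _ _ (by omega) h0
  obtain ⟨l1, -⟩ := drv_len hm _ _ _ _ (by omega) h1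
  simp [fam] at hlen l1
  exact ⟨by omega, by omega, fun h3 => e0 h3 g g' k k'⟩

/-- blocks -/
def blocks : List ℕ → List (Fin 2)
  | [] => []
  | e :: t => List.replicate e 0 ++ 1 :: 0 :: blocks t

lemma blocks_cnt (t : List ℕ) (k : ℕ) : cnt (blocks t ++ List.replicate k 0) = t.length := by
  induction t with
  | nil => simp [blocks, cnt, List.count_replicate]
  | cons e t ih =>
    simp only [blocks, List.append_assoc, List.cons_append, cnt_zeros, cnt_one, cnt_zero, ih,
      List.length_cons]

lemma good_zeros (a : ℕ) (l : List (Fin 2)) (h : Good l) : Good (List.replicate a 0 ++ l) := by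
  induction a with
  | zero => simpa
  | succ a ih =>
    rw [List.replicate_succ, List.cons_append]
    exact ⟨fun h => by simp at h, ih⟩

lemma blocks_good (t : List ℕ) (k : ℕ) : Good (blocks t ++ List.replicate k 0) := by
  induction t with
  | nil =>
    have := good_zeros k [] trivial
    simpa [blocks] using this
  | cons e t ih =>
    simp only [blocks, List.append_assoc, List.cons_append]
    exact good_zeros _ _ ⟨fun _ => ⟨_, rfl⟩, fun h => by simp at h, ih⟩

lemma zeros_one_inj {a b : ℕ} {x y : List (Fin 2)}
    (h : List.replicate a 0 ++ 1 :: x = List.replicate b 0 ++ 1 :: y) : a = b ∧ x = y := by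
  induction a generalizing b with
  | zero =>
    cases b with
    | zero => simpa using h
    | succ b => simp [List.replicate_succ] at h
  | succ a ih =>
    cases b with
    | zero => simp [List.replicate_succ] at h
    | succ b =>
      simp only [List.replicate_succ, List.cons_append, List.cons.injEq, true_and] at h
      have := ih h
      exact ⟨by omega, this.2⟩

lemma blocks_inj (t t' : List ℕ) (k k' : ℕ) (hl : t.length = t'.length)
    (h : blocks t ++ List.replicate k 0 = blocks t' ++ List.replicate k' 0) : t = t' := by
  induction t generalizing t' with
  | nil => exact (List.eq_nil_of_length_eq_zero hl.symm).symm
  | cons e t ih =>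
    cases t' with
    | nil => simp at hl
    | cons e' t' =>
      simp only [blocks, List.append_assoc, List.cons_append] at h
      obtain ⟨h1, h2⟩ := zeros_one_inj h
      rw [h1, ih t' (by simpa using hl) (List.cons.inj h2).2]

lemma blocks_length (t : List ℕ) (n : ℕ) (h : ∀ e ∈ t, e ≤ n) :
    (blocks t).length ≤ t.length * (n + 2) := by
  induction t with
  | nil => simp [blocks]
  | cons e t ih =>
    have h1 := ih fun a ha => h a (List.mem_cons_of_mem _ ha)
    have h2 := h e List.mem_cons_self
    simp only [blocks, List.length_append, List.length_replicate, List.length_cons]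
    rw [Nat.add_mul]; omega

lemma lower {m : ℕ} (hm : 3 ≤ m) (n : ℕ) (hn : 1 ≤ n) :
    n ^ (m - 1) ≤ growth (bmTr m) (bmOut m) ((4 + 3 * m) * n) := by
  rw [growth_eq]
  set N := (4 + 3 * m) * n with hN
  let T : (Fin (m - 3) → Fin n) → List ℕ := fun p => List.ofFn fun i => (p i : ℕ)
  let K : Fin n × Fin n × (Fin (m - 3) → Fin n) → ℕ := fun p =>
    N - (2 * p.1 + 1 + (2 * p.2.1 + 1) + (blocks (T p.2.2)).length)
  let W : Fin n × Fin n × (Fin (m - 3) → Fin n) → List (Fin 2) := fun p =>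
    fam p.1 p.2.1 (blocks (T p.2.2) ++ List.replicate (K p) 0)
  have hT : ∀ p, (T p).length = m - 3 := fun p => by simp [T]
  have hW : ∀ p, (W p).length = N := by
    intro p
    have h1 := blocks_length (T p.2.2) n (by
      intro e he
      simp only [T, List.mem_ofFn] at he
      obtain ⟨i, rfl⟩ := he
      exact (p.2.2 i).2.le)
    rw [hT] at h1
    have h2 := p.1.2
    have h3 := p.2.1.2
    have h4 : (m - 3) * (n + 2) ≤ m * (3 * n) := Nat.mul_le_mul (by omega) (by omega)
    have h5 : N = 4 * n + m * (3 * n) := by rw [hN]; ring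
    simp only [W, fam, K, List.length_append, List.length_replicate, List.length_cons]
    omega
  have hinj : Function.Injective fun p => act m (W p) := by
    intro p p' h
    have := fam_inj hm ((hW p).trans (hW p').symm) (blocks_good _ _) (blocks_good _ _)
      (by rw [blocks_cnt, hT]) (by rw [blocks_cnt, hT]) h
    obtain ⟨e1, e2, e3⟩ := this
    refine Prod.ext (Fin.ext e1) (Prod.ext (Fin.ext e2) ?_)
    by_cases h3 : m = 3
    · funext i
      exact absurd i.2 (by omega)
    · have := blocks_inj _ _ _ _ ((hT _).trans (hT _).symm) (e3 h3)
      have h5 := List.ofFn_injective this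
      funext i
      exact Fin.ext (congrFun h5 i)
  have hfin : (Set.image (act m) {w : List (Fin 2) | w.length = N}).Finite :=
    (List.finite_length_eq (Fin 2) N).image _
  have hsub : Set.range (fun p => act m (W p)) ⊆ Set.image (act m) {w : List (Fin 2) | w.length = N} := by
    rintro _ ⟨p, rfl⟩
    exact ⟨W p, hW p, rfl⟩
  have hcard : (Set.range (fun p => act m (W p))).ncard = n ^ (m - 1) := by
    rw [← Set.image_univ, Set.ncard_image_of_injective _ hinj, Set.ncard_univ]
    simp only [Nat.card_eq_fintype_card, Fintype.card_prod, Fintype.card_fin, Fintype.card_fun]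
    rw [show m - 1 = (m - 3) + 2 by omega, pow_add]; ring
  rw [← hcard]
  exact Set.ncard_le_ncard hsub hfin

end BM

/-- For every `m ≥ 3`, the growth function `γ` of the automaton `B_m` has growth order
`[n^(m−1)]`: there exist `C₁, C₂, N₀ ≥ 1` such that for all `n ≥ N₀`,
`γ(n) ≤ C₁·(C₂·n)^(m−1)` and `n^(m−1) ≤ C₁·γ(C₂·n)`. -/
theorem growth_order_bm (m : ℕ) (hm : 3 ≤ m) :
    ∃ C₁ C₂ N₀ : ℕ, 1 ≤ C₁ ∧ 1 ≤ C₂ ∧ 1 ≤ N₀ ∧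
      ∀ n : ℕ, N₀ ≤ n →
        growth (bmTr m) (bmOut m) n ≤ C₁ * (C₂ * n) ^ (m - 1) ∧
        n ^ (m - 1) ≤ C₁ * growth (bmTr m) (bmOut m) (C₂ * n) := by
  refine ⟨1, 4 + 3 * m, 1, le_rfl, by omega, le_rfl, fun n hn => ⟨?_, ?_⟩⟩
  · rw [one_mul]
    refine (BM.upper hm n).trans (Nat.pow_le_pow_left ?_ _)
    nlinarith
  · rw [one_mul]
    exact BM.lower hm n hn
end
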